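/- arXiv:2105.04204 — 3 statements merged into one kernel-verified Lean document; each statement's English description precedes it below -/
import Mathlib

section
/- Let a, b be rational integers with 2 ≤ a ≤ b−2, let ρ be the largest real root of x³ − (a+b)x² + abx − 1, and let v, w be integers with 0 ≤ v ≤ b−a−1 and va ≤ w ≤ (v+1)a − 1. For α = −v + (bw+1)ρ − wρ², the minimum of Tr_{K/ℚ}(αδ) over all δ ∈ ℤ[ρ]^{∨,+} equals min{b − a − v + 1, w − av + 1}. -/
open IntermediateField

noncomputable section

/-- An element of a field `K` is totally positive if its image under every
real embedding of `K` is positive. -/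
def TotallyPositive {K : Type*} [Field K] (x : K) : Prop :=
  ∀ φ : K →+* ℝ, 0 < φ x

/-- A totally positive element `α` of an order `O` is (additively) indecomposable in `O`
if it cannot be written as a sum of two totally positive elements of `O`. -/
def IsIndecomposableIn {K : Type*} [Field K] (O : Subalgebra ℤ K) (α : K) : Prop :=
  α ∈ O ∧ TotallyPositive α ∧
    ¬ ∃ β γ : K, β ∈ O ∧ γ ∈ O ∧ TotallyPositive β ∧ TotallyPositive γ ∧ α = β + γ

/-- The set of totally positive elements of the codifferent of an order `O`. -/
def CodifferentPlus {K : Type*} [Field K] [Algebra ℚ K] (O : Subalgebra ℤ K) : Set K :=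
  {δ : K | TotallyPositive δ ∧ ∀ α ∈ O, ∃ n : ℤ, Algebra.trace ℚ K (α * δ) = (n : ℚ)}

theorem exists_setup (a b : ℤ) (ρ : ℝ)
    (hroot : ρ ^ 3 - ((a : ℝ) + (b : ℝ)) * ρ ^ 2 + (a : ℝ) * (b : ℝ) * ρ - 1 = 0)
    (hdeg : Module.finrank ℚ ℚ⟮ρ⟯ = 3) :
    (∃ B : Module.Basis (Fin 3) ℚ ℚ⟮ρ⟯, ∀ i, B i = AdjoinSimple.gen ℚ ρ ^ (i : ℕ)) ∧
    (∀ r : ℝ, r ^ 3 - ((a : ℝ) + (b : ℝ)) * r ^ 2 + (a : ℝ) * (b : ℝ) * r - 1 = 0 →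
      ∃ φ : ℚ⟮ρ⟯ →+* ℝ, φ (AdjoinSimple.gen ℚ ρ) = r) := by
  let f : Polynomial ℚ := Polynomial.X ^ 3 - Polynomial.C ((a : ℚ) + b) * Polynomial.X ^ 2
    + Polynomial.C ((a : ℚ) * b) * Polynomial.X - 1
  have hfd : f.natDegree = 3 := by
    simp only [f]; compute_degree!
  have hfm : f.Monic := by
    simp only [f]; monicity!
  have hev : ∀ r : ℝ, Polynomial.aeval r f =
      r ^ 3 - ((a : ℝ) + (b : ℝ)) * r ^ 2 + (a : ℝ) * (b : ℝ) * r - 1 := by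
    intro r
    simp [f]
  have hint : IsIntegral ℚ ρ := ⟨f, hfm, by
    have := hev ρ
    rw [hroot] at this
    simpa [Polynomial.aeval_def] using this⟩
  have hmd : (minpoly ℚ ρ).natDegree = 3 := by
    rw [← adjoin.finrank hint, hdeg]
  have hmf : minpoly ℚ ρ = f := by
    symm
    apply Polynomial.eq_of_monic_of_dvd_of_natDegree_le (minpoly.monic hint) hfm
    · exact minpoly.dvd _ _ (by rw [hev, hroot])
    · rw [hfd, hmd]
  let pb := adjoin.powerBasis hint
  have hdim : pb.dim = 3 := by
    simp [pb, hmd]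
  have hgen : pb.gen = AdjoinSimple.gen ℚ ρ := by simp [pb]
  constructor
  · refine ⟨pb.basis.reindex (finCongr hdim), fun i => ?_⟩
    simp [hgen]
  · intro r hr
    have h0 : Polynomial.aeval r (minpoly ℚ pb.gen) = 0 := by
      have hm : minpoly ℚ pb.gen = minpoly ℚ ρ := by
        rw [hgen]
        exact IntermediateField.minpoly_gen ℚ ρ
      rw [hm, hmf, hev, hr]
    refine ⟨(pb.lift r h0).toRingHom, ?_⟩
    rw [← hgen]
    exact pb.lift_gen r h0

theorem trace_formulas {K : Type*} [Field K] [Algebra ℚ K] (B : Module.Basis (Fin 3) ℚ K)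
    (γ : K) (hB : ∀ i, B i = γ ^ (i : ℕ)) (s p : ℚ)
    (hγ : γ ^ 3 = s • γ ^ 2 - p • γ + 1) :
    Algebra.trace ℚ K 1 = 3 ∧ Algebra.trace ℚ K γ = s ∧
      Algebra.trace ℚ K (γ ^ 2) = s ^ 2 - 2 * p := by
  have h0 : B 0 = 1 := by simp [hB]
  have h1 : B 1 = γ := by simp [hB]
  have h2 : B 2 = γ ^ 2 := by simp [hB]
  have g3 : γ ^ 3 = s • B 2 - p • B 1 + B 0 := by rw [h0, h1, h2, hγ]
  have g4 : γ ^ 4 = (s ^ 2 - p) • B 2 + (1 - s * p) • B 1 + s • B 0 := by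
    rw [h0, h1, h2]
    have : γ ^ 4 = γ ^ 3 * γ := by ring
    rw [this, hγ]
    have : (s • γ ^ 2 - p • γ + 1) * γ = s • γ ^ 3 - p • γ ^ 2 + γ := by
      simp only [Algebra.smul_def]; ring
    rw [this, hγ]
    simp only [Algebra.smul_def, map_sub, map_mul, map_pow, map_one]; ring
  refine ⟨?_, ?_, ?_⟩
  · rw [Algebra.trace_eq_matrix_trace B]
    simp
  · rw [Algebra.trace_eq_matrix_trace B, Matrix.trace, Fin.sum_univ_three]
    simp only [Matrix.diag_apply, Algebra.leftMulMatrix_eq_repr_mul]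
    have e0 : γ * B 0 = B 1 := by rw [h0, h1]; ring
    have e1 : γ * B 1 = B 2 := by rw [h1, h2]; ring
    have e2 : γ * B 2 = s • B 2 - p • B 1 + B 0 := by rw [← g3, h2]; ring
    rw [e0, e1, e2]
    simp
  · rw [Algebra.trace_eq_matrix_trace B, Matrix.trace, Fin.sum_univ_three]
    simp only [Matrix.diag_apply, Algebra.leftMulMatrix_eq_repr_mul]
    have e0 : γ ^ 2 * B 0 = B 2 := by rw [h0, h2]; ring
    have e1 : γ ^ 2 * B 1 = s • B 2 - p • B 1 + B 0 := by rw [← g3, h1]; ring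
    have e2 : γ ^ 2 * B 2 = (s ^ 2 - p) • B 2 + (1 - s * p) • B 1 + s • B 0 := by
      rw [← g4, h2]; ring
    rw [e0, e1, e2]
    simp
    ring

/-- Data on `δ`: its coordinates, with `Tr (γ^k δ)` expressed in them. -/
theorem trace_coords {K : Type*} [Field K] [Algebra ℚ K] (B : Module.Basis (Fin 3) ℚ K)
    (γ : K) (hB : ∀ i, B i = γ ^ (i : ℕ)) (s p : ℚ)
    (hγ : γ ^ 3 = s • γ ^ 2 - p • γ + 1) (δ : K) :
    ∃ x y z : ℚ, δ = x • (1 : K) + y • γ + z • γ ^ 2 ∧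
      Algebra.trace ℚ K δ = 3 * x + s * y + (s ^ 2 - 2 * p) * z ∧
      Algebra.trace ℚ K (γ * δ) = s * x + (s ^ 2 - 2 * p) * y
        + (s * (s ^ 2 - 2 * p) - p * s + 3) * z ∧
      Algebra.trace ℚ K (γ ^ 2 * δ) = (s ^ 2 - 2 * p) * x
        + (s * (s ^ 2 - 2 * p) - p * s + 3) * y
        + (s * (s * (s ^ 2 - 2 * p) - p * s + 3) - p * (s ^ 2 - 2 * p) + s) * z := by
  obtain ⟨t0, t1, t2⟩ := trace_formulas B γ hB s p hγ
  have hδ : δ = B.repr δ 0 • (1 : K) + B.repr δ 1 • γ + B.repr δ 2 • γ ^ 2 := by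
    conv_lhs => rw [← B.sum_repr δ]
    simp [Fin.sum_univ_three, hB]
  generalize B.repr δ 0 = x at hδ
  generalize B.repr δ 1 = y at hδ
  generalize B.repr δ 2 = z at hδ
  have t3 : Algebra.trace ℚ K (γ ^ 3) = s * (s ^ 2 - 2 * p) - p * s + 3 := by
    rw [hγ, map_add, map_sub, map_smul, map_smul, t0, t1, t2]; simp
  have t4 : Algebra.trace ℚ K (γ ^ 4) =
      s * (s * (s ^ 2 - 2 * p) - p * s + 3) - p * (s ^ 2 - 2 * p) + s := by
    have : γ ^ 4 = s • γ ^ 3 - p • γ ^ 2 + γ := by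
      have : γ ^ 4 = γ ^ 3 * γ := by ring
      rw [this, hγ]
      have : (s • γ ^ 2 - p • γ + 1) * γ = s • γ ^ 3 - p • γ ^ 2 + γ := by
        simp only [Algebra.smul_def]; ring
      rw [this, hγ]
    rw [this, map_add, map_sub, map_smul, map_smul, t3, t1, t2]; simp
  refine ⟨x, y, z, hδ, ?_, ?_, ?_⟩
  · rw [hδ, map_add, map_add, map_smul, map_smul, map_smul, t0, t1, t2]
    simp only [smul_eq_mul]; ring
  · have : γ * δ = x • γ + y • γ ^ 2 + z • γ ^ 3 := by
      rw [hδ]; simp only [Algebra.smul_def]; ring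
    rw [this, map_add, map_add, map_smul, map_smul, map_smul, t3, t1, t2]
    simp only [smul_eq_mul]; ring
  · have : γ ^ 2 * δ = x • γ ^ 2 + y • γ ^ 3 + z • γ ^ 4 := by
      rw [hδ]; simp only [Algebra.smul_def]; ring
    rw [this, map_add, map_add, map_smul, map_smul, map_smul, t3, t4, t2]
    simp only [smul_eq_mul]; ring

/-- The value of `δ` at an embedding from the three traces. -/
theorem embedding_formula {K : Type*} [Field K] [Algebra ℚ K] (B : Module.Basis (Fin 3) ℚ K)
    (γ : K) (hB : ∀ i, B i = γ ^ (i : ℕ)) (s p : ℚ)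
    (hγ : γ ^ 3 = s • γ ^ 2 - p • γ + 1) (δ : K) (t0 t1 t2 : ℚ)
    (h0 : Algebra.trace ℚ K δ = t0) (h1 : Algebra.trace ℚ K (γ * δ) = t1)
    (h2 : Algebra.trace ℚ K (γ ^ 2 * δ) = t2) (φ : K →+* ℝ) :
    φ δ * (3 * φ γ ^ 2 - 2 * s * φ γ + p) =
      t2 + (φ γ - s) * t1 + (φ γ ^ 2 - s * φ γ + p) * t0 := by
  obtain ⟨x, y, z, hδ, e0, e1, e2⟩ := trace_coords B γ hB s p hγ δ
  have hs : ∀ (q : ℚ) (u : K), φ (q • u) = q * φ u := by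
    intro q u
    rw [Algebra.smul_def, map_mul]
    simp
  have hr : φ γ ^ 3 = s * φ γ ^ 2 - p * φ γ + 1 := by
    have := congrArg φ hγ
    simpa [hs] using this
  have hd : φ δ = x + y * φ γ + z * φ γ ^ 2 := by
    rw [hδ]; simp [hs]
  rw [← h0, ← h1, ← h2, e0, e1, e2, hd]
  push_cast
  generalize φ γ = r at *
  linear_combination (3 * y + 3 * z * r + s * z) * hr

/-- The trace is the sum over three distinct real embeddings. -/
theorem trace_sum {K : Type*} [Field K] [Algebra ℚ K] (B : Module.Basis (Fin 3) ℚ K)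
    (γ : K) (hB : ∀ i, B i = γ ^ (i : ℕ)) (s p : ℚ)
    (hγ : γ ^ 3 = s • γ ^ 2 - p • γ + 1) (δ : K) (φ φ' φ'' : K →+* ℝ)
    (n1 : φ γ ≠ φ' γ) (n2 : φ γ ≠ φ'' γ) (n3 : φ' γ ≠ φ'' γ) :
    ((Algebra.trace ℚ K δ : ℚ) : ℝ) = φ δ + φ' δ + φ'' δ := by
  obtain ⟨x, y, z, hδ, e0, -, -⟩ := trace_coords B γ hB s p hγ δ
  have hs : ∀ (φ : K →+* ℝ) (q : ℚ) (u : K), φ (q • u) = q * φ u := by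
    intro φ q u
    rw [Algebra.smul_def, map_mul]
    simp
  have hr : ∀ (φ : K →+* ℝ), φ γ ^ 3 = s * φ γ ^ 2 - p * φ γ + 1 := by
    intro φ
    have := congrArg φ hγ
    simpa [hs] using this
  have hd : ∀ (φ : K →+* ℝ), φ δ = x + y * φ γ + z * φ γ ^ 2 := by
    intro φ
    rw [hδ]; simp [hs]
  have r1 := hr φ
  have r2 := hr φ'
  have r3 := hr φ''
  rw [e0, hd φ, hd φ', hd φ'']
  push_cast
  generalize φ γ = u at *
  generalize φ' γ = v at *
  generalize φ'' γ = w at *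
  have q1 : u ^ 2 + u * v + v ^ 2 - s * (u + v) + p = 0 := by
    apply mul_left_cancel₀ (sub_ne_zero.2 n1)
    linear_combination r1 - r2
  have q2 : u ^ 2 + u * w + w ^ 2 - s * (u + w) + p = 0 := by
    apply mul_left_cancel₀ (sub_ne_zero.2 n2)
    linear_combination r1 - r3
  have q3 : u + v + w - s = 0 := by
    apply mul_left_cancel₀ (sub_ne_zero.2 n3)
    linear_combination q1 - q2
  have hw : w = s - u - v := by linear_combination q3
  subst hw
  linear_combination (-2 * z) * q1

theorem exists_of_traces {K : Type*} [Field K] [Algebra ℚ K] (B : Module.Basis (Fin 3) ℚ K)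
    (γ : K) (hB : ∀ i, B i = γ ^ (i : ℕ)) (t0 t1 t2 : ℚ) :
    ∃ δ : K, Algebra.trace ℚ K δ = t0 ∧ Algebra.trace ℚ K (γ * δ) = t1 ∧
      Algebra.trace ℚ K (γ ^ 2 * δ) = t2 := by
  have : FiniteDimensional ℚ K := Module.Finite.of_basis B
  have h0 : B 0 = 1 := by simp [hB]
  have h1 : B 1 = γ := by simp [hB]
  have h2 : B 2 = γ ^ 2 := by simp [hB]
  have key : ∀ i, Algebra.trace ℚ K (B i * (t0 • B.traceDual 0 + t1 • B.traceDual 1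
      + t2 • B.traceDual 2)) = ![t0, t1, t2] i := by
    intro i
    simp only [mul_add, mul_smul_comm, map_add, map_smul, Module.Basis.trace_mul_traceDual]
    fin_cases i <;> simp
  refine ⟨t0 • B.traceDual 0 + t1 • B.traceDual 1 + t2 • B.traceDual 2, ?_, ?_, ?_⟩
  · simpa [h0] using key 0
  · simpa [h1] using key 1
  · simpa [h2] using key 2

theorem adjoin_form {K : Type*} [Field K] (γ : K) (s p : ℤ)
    (hγ : γ ^ 3 = s * γ ^ 2 - p * γ + 1) (α : K) (hα : α ∈ Algebra.adjoin ℤ {γ}) :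
    ∃ x y z : ℤ, α = x + y * γ + z * γ ^ 2 := by
  induction hα using Algebra.adjoin_induction with
  | mem x hx =>
    rw [Set.mem_singleton_iff.1 hx]
    exact ⟨0, 1, 0, by simp⟩
  | algebraMap r => exact ⟨r, 0, 0, by simp⟩
  | add u v _ _ hu hv =>
    obtain ⟨x, y, z, rfl⟩ := hu
    obtain ⟨x', y', z', rfl⟩ := hv
    exact ⟨x + x', y + y', z + z', by push_cast; ring⟩
  | mul u v _ _ hu hv =>
    obtain ⟨x, y, z, rfl⟩ := hu
    obtain ⟨x', y', z', rfl⟩ := hv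
    refine ⟨x * x' + (y * z' + z * y') + z * z' * s,
      x * y' + y * x' - p * (y * z' + z * y') + z * z' * (1 - s * p),
      x * z' + y * y' + z * x' + s * (y * z' + z * y') + z * z' * (s ^ 2 - p), ?_⟩
    push_cast
    linear_combination (y * z' + z * y' + z * z' * (γ + s)) * hγ

theorem mem_codiff {K : Type*} [Field K] [Algebra ℚ K] (γ : K) (s p : ℤ)
    (hγ : γ ^ 3 = s * γ ^ 2 - p * γ + 1) (δ : K) (t0 t1 t2 : ℤ)
    (h0 : Algebra.trace ℚ K δ = t0) (h1 : Algebra.trace ℚ K (γ * δ) = t1)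
    (h2 : Algebra.trace ℚ K (γ ^ 2 * δ) = t2) (α : K) (hα : α ∈ Algebra.adjoin ℤ {γ}) :
    ∃ n : ℤ, Algebra.trace ℚ K (α * δ) = n := by
  obtain ⟨x, y, z, rfl⟩ := adjoin_form γ s p hγ α hα
  refine ⟨x * t0 + y * t1 + z * t2, ?_⟩
  have : ((x : K) + y * γ + z * γ ^ 2) * δ = x • δ + y • (γ * δ) + z • (γ ^ 2 * δ) := by
    simp only [zsmul_eq_mul]; ring
  rw [this, map_add, map_add, map_zsmul, map_zsmul, map_zsmul, h0, h1, h2]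
  simp

theorem lower_bound (a b v w t0 t1 t2 : ℤ) (ha : 2 ≤ a) (hab : a ≤ b - 2)
    (hv0 : 0 ≤ v) (hv1 : v ≤ b - a - 1) (hw0 : v * a ≤ w) (hw1 : w ≤ (v + 1) * a - 1)
    (r : ℝ) (h1 : (a : ℝ) - 1 < r) (h2 : r < a)
    (hr : r ^ 3 - ((a : ℝ) + (b : ℝ)) * r ^ 2 + (a : ℝ) * (b : ℝ) * r - 1 = 0)
    (ht0 : 0 < t0) (ht1 : 0 < t1)
    (hE : (t2 : ℝ) + (r - (a + b)) * t1 + (r ^ 2 - (a + b) * r + a * b) * t0 < 0) :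
    min (b - a - v + 1) (w - a * v + 1) ≤ -v * t0 + (b * w + 1) * t1 - w * t2 := by
  obtain ⟨u, hu⟩ : ∃ u : ℤ, u = b * t1 - t2 := ⟨_, rfl⟩
  obtain rfl : t2 = b * t1 - u := by omega
  obtain ⟨k, rfl⟩ : ∃ k : ℤ, w = v * a + k := ⟨w - v * a, by ring⟩
  have haR : (2 : ℝ) ≤ a := by exact_mod_cast ha
  have habR : (a : ℝ) ≤ b - 2 := by exact_mod_cast hab
  have hv0R : (0 : ℝ) ≤ v := by exact_mod_cast hv0
  have hv1R : (v : ℝ) ≤ b - a - 1 := by exact_mod_cast hv1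
  have hk0R : (0 : ℝ) ≤ k := by exact_mod_cast (by linarith : 0 ≤ k)
  have hk1R : (k : ℝ) ≤ a - 1 := by exact_mod_cast (by linarith : k ≤ a - 1)
  have ht0R : (1 : ℝ) ≤ t0 := by exact_mod_cast ht0
  have ht1R : (0 : ℝ) < t1 := by exact_mod_cast ht1
  push_cast at hE
  have hr0 : 0 < r := by linarith
  have hbr : 0 < b - r := by linarith
  have key : ((b : ℝ) - r) * t0 < (b - r) * r * u + t1 := by
    have h : ((b : ℝ) - r) * t0 - ((b - r) * r * u + t1) = (b - r) * r *
      (((b : ℝ) * t1 - u) + (r - (a + b)) * t1 + (r ^ 2 - (a + b) * r + a * b) * t0) := by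
      linear_combination ((t1 : ℝ) - (b - r) * t0) * hr
    have := mul_neg_of_pos_of_neg (mul_pos hbr hr0) hE
    linarith
  rcases le_or_gt u 0 with hu0 | hu0
  · refine (min_le_left _ _).trans ?_
    have huR : (u : ℝ) ≤ 0 := by exact_mod_cast hu0
    have hP : (v : ℝ) * a + k ≤ r * (b - r) := by
      have hP1 : (a : ℝ) * (b - a) - 1 ≤ r * (b - r) := by
        have e : (a - r) * (r * (b - r)) = 1 := by linear_combination hr
        have hP2 : (b : ℝ) - r < r * (b - r) := by nlinarith
        nlinarith
      nlinarith
    have : ((b - a - v : ℤ) : ℝ) < ((-v * t0 + (b * (v * a + k) + 1) * t1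
        - (v * a + k) * (b * t1 - u) : ℤ) : ℝ) := by
      push_cast
      have m1 : 0 ≤ (r * (b - r) - (v * a + k)) * (-u) := mul_nonneg (by linarith) (by linarith)
      have m2 : 0 ≤ ((b : ℝ) - r - v) * (t0 - 1) := mul_nonneg (by linarith) (by linarith)
      nlinarith
    have := Int.cast_lt.1 this
    omega
  · refine (min_le_right _ _).trans ?_
    have huR : (1 : ℝ) ≤ u := by exact_mod_cast hu0
    have hlt : (v : ℝ) * (t0 - a * u) < t1 := by
      rcases le_or_gt ((t0 : ℝ) - a * u) 0 with h | h
      · have := mul_nonneg hv0R (neg_nonneg.2 h)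
        linarith
      · have m1 : 0 ≤ ((b : ℝ) - r - v) * (t0 - a * u) := mul_nonneg (by linarith) h.le
        have m2 : 0 ≤ ((b : ℝ) - r) * ((a - r) * u) :=
          mul_nonneg hbr.le (mul_nonneg (by linarith) (by linarith))
        linarith
    have : ((k : ℤ) : ℝ) < ((-v * t0 + (b * (v * a + k) + 1) * t1
        - (v * a + k) * (b * t1 - u) : ℤ) : ℝ) := by
      push_cast
      have m1 : 0 ≤ (k : ℝ) * (u - 1) := mul_nonneg hk0R (by linarith)
      linarith
    have := Int.cast_lt.1 this
    linarith

theorem root_cases (a b r : ℝ) (ha : 2 ≤ a) (hab : a ≤ b - 2)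
    (hr : r ^ 3 - (a + b) * r ^ 2 + a * b * r - 1 = 0) :
    (b < r ∧ 0 < 3 * r ^ 2 - 2 * (a + b) * r + a * b) ∨
    (a - 1 < r ∧ r < a ∧ 3 * r ^ 2 - 2 * (a + b) * r + a * b < 0) ∨
    (0 < r ∧ r < 1 ∧ 0 < 3 * r ^ 2 - 2 * (a + b) * r + a * b) := by
  have e : r * ((a - r) * (b - r)) = 1 := by linear_combination hr
  have hd : 3 * r ^ 2 - 2 * (a + b) * r + a * b =
    (a - r) * (b - r) - r * (b - r) - r * (a - r) := by ring
  rw [hd]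
  have hr0 : 0 < r := by
    by_contra h
    push Not at h
    have : 0 < (a - r) * (b - r) := mul_pos (by linarith) (by linarith)
    nlinarith
  rcases lt_or_ge b r with h | h
  · left
    refine ⟨h, ?_⟩
    have m1 : 0 < (r - a) * (r - b) := mul_pos (by linarith) (by linarith)
    have m2 : 0 < r * (r - b) := mul_pos (by linarith) (by linarith)
    have m3 : 0 < r * (r - a) := mul_pos (by linarith) (by linarith)
    linarith
  right
  have hra : r < a := by
    by_contra h'
    push Not at h'
    have m1 : 0 ≤ (r - a) * (b - r) := mul_nonneg (by linarith) (by linarith)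
    nlinarith
  rcases lt_or_ge (a - 1) r with h1 | h1
  · left
    refine ⟨h1, hra, ?_⟩
    have m1 : 0 ≤ (b - r) * (2 * r - a) := mul_nonneg (by linarith) (by linarith)
    have m2 : 0 < r * (a - r) := mul_pos hr0 (by linarith)
    linarith
  · right
    have h3 : 1 * 3 ≤ (a - r) * (b - r) := mul_le_mul (by linarith) (by linarith)
      (by norm_num) (by linarith)
    have h4 : r ≤ 1 / 3 := by nlinarith
    refine ⟨hr0, by linarith, ?_⟩
    have m1 : 0 ≤ (1 / 3 - r) * (b - r) := mul_nonneg (by linarith) (by linarith)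
    have m2 : 0 ≤ (1 / 3 - r) * (a - r) := mul_nonneg (by linarith) (by linarith)
    have m3 : 0 ≤ (a - r - 5 / 3) * (b - r - 11 / 3) := mul_nonneg (by linarith) (by linarith)
    nlinarith

theorem exists_roots (a b : ℝ) (ha : 2 ≤ a) (hab : a ≤ b - 2) :
    ∃ r r' r'' : ℝ, b < r ∧ (a - 1 < r' ∧ r' < a) ∧ (0 < r'' ∧ r'' < 1) ∧
      r ^ 3 - (a + b) * r ^ 2 + a * b * r - 1 = 0 ∧
      r' ^ 3 - (a + b) * r' ^ 2 + a * b * r' - 1 = 0 ∧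
      r'' ^ 3 - (a + b) * r'' ^ 2 + a * b * r'' - 1 = 0 := by
  have hc : Continuous fun x : ℝ => x ^ 3 - (a + b) * x ^ 2 + a * b * x - 1 := by fun_prop
  obtain ⟨r, hr, hr'⟩ := intermediate_value_Ioo (by linarith : b ≤ b + 1) hc.continuousOn
    (show (0 : ℝ) ∈ _ from ⟨by ring_nf; norm_num, by nlinarith⟩)
  obtain ⟨q, hq, hq'⟩ := intermediate_value_Ioo' (by linarith : a - 1 ≤ a) hc.continuousOn
    (show (0 : ℝ) ∈ _ from ⟨by ring_nf; norm_num, by nlinarith⟩)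
  obtain ⟨p, hp, hp'⟩ := intermediate_value_Ioo (by norm_num : (0 : ℝ) ≤ 1) hc.continuousOn
    (show (0 : ℝ) ∈ _ from ⟨by ring_nf; norm_num, by nlinarith⟩)
  exact ⟨r, q, p, hr.1, hq, hp, hr', hq', hp'⟩

/-- Sign check for `(t0, t1, t2) = (a, 1, b - 1)`. -/
theorem pos_one (a b r d : ℝ) (ha : 2 ≤ a) (hab : a ≤ b - 2)
    (hr : r ^ 3 - (a + b) * r ^ 2 + a * b * r - 1 = 0)
    (hd : d * (3 * r ^ 2 - 2 * (a + b) * r + a * b) =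
      (b - 1) + (r - (a + b)) * 1 + (r ^ 2 - (a + b) * r + a * b) * a) : 0 < d := by
  have e : r * ((a - r) * (b - r)) = 1 := by linear_combination hr
  have hE : (b - 1) + (r - (a + b)) * 1 + (r ^ 2 - (a + b) * r + a * b) * a
    = r - a - 1 + a * ((a - r) * (b - r)) := by ring
  rw [hE] at hd
  rcases root_cases a b r ha hab hr with ⟨h, hf⟩ | ⟨h, h', hf⟩ | ⟨h, h', hf⟩
  · have m : 0 < (r - a) * (r - b) := mul_pos (by linarith) (by linarith)
    have : 0 < r - a - 1 + a * ((a - r) * (b - r)) := by nlinarith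
    rw [← hd] at this
    exact pos_of_mul_pos_left this hf.le
  · have : r - a - 1 + a * ((a - r) * (b - r)) < 0 := by
      have h0 : 0 < r := by linarith
      have h1 : r * (r - a - 1 + a * ((a - r) * (b - r))) = (r - 1) * (r - a) := by
        linear_combination a * e
      have h2 : (r - 1) * (r - a) < 0 := mul_neg_of_pos_of_neg (by linarith) (by linarith)
      rw [← h1] at h2
      exact neg_of_mul_neg_right h2 h0.le
    rw [← hd] at this
    exact (pos_iff_neg_of_mul_neg this).2 hf
  · have h3 : 1 * 3 ≤ (a - r) * (b - r) := mul_le_mul (by linarith) (by linarith)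
      (by norm_num) (by linarith)
    have : 0 < r - a - 1 + a * ((a - r) * (b - r)) := by nlinarith
    rw [← hd] at this
    exact pos_of_mul_pos_left this hf.le

/-- Sign check for `(t0, t1, t2) = (1, b - a + 1, b (b - a + 1))`. -/
theorem pos_two (a b r d : ℝ) (ha : 2 ≤ a) (hab : a ≤ b - 2)
    (hr : r ^ 3 - (a + b) * r ^ 2 + a * b * r - 1 = 0)
    (hd : d * (3 * r ^ 2 - 2 * (a + b) * r + a * b) =
      b * (b - a + 1) + (r - (a + b)) * (b - a + 1)
        + (r ^ 2 - (a + b) * r + a * b) * 1) : 0 < d := by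
  have hE : b * (b - a + 1) + (r - (a + b)) * (b - a + 1)
        + (r ^ 2 - (a + b) * r + a * b) * 1 = (r - a) * (r - a + 1) := by ring
  rw [hE] at hd
  rcases root_cases a b r ha hab hr with ⟨h, hf⟩ | ⟨h, h', hf⟩ | ⟨h, h', hf⟩
  · have : 0 < (r - a) * (r - a + 1) := mul_pos (by linarith) (by linarith)
    rw [← hd] at this
    exact pos_of_mul_pos_left this hf.le
  · have : (r - a) * (r - a + 1) < 0 := mul_neg_of_neg_of_pos (by linarith) (by linarith)
    rw [← hd] at this
    exact (pos_iff_neg_of_mul_neg this).2 hf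
  · have : 0 < (r - a) * (r - a + 1) := mul_pos_of_neg_of_neg (by linarith) (by linarith)
    rw [← hd] at this
    exact pos_of_mul_pos_left this hf.le

/-- Let `2 ≤ a ≤ b−2`, `ρ` the largest real root of
`x³ − (a+b)x² + abx − 1`, and `v, w` integers with `0 ≤ v ≤ b−a−1`, `va ≤ w ≤ (v+1)a−1`.
For `α = −v + (bw+1)ρ − wρ²`, the minimum of `Tr_{K/ℚ}(αδ)` over all `δ ∈ ℤ[ρ]^{∨,+}`
equals `min{b − a − v + 1, w − av + 1}`. -/
theorem stmt_14 (a b : ℤ) (ha : 2 ≤ a) (hab : a ≤ b - 2)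
    (ρ : ℝ) (hroot : ρ ^ 3 - ((a : ℝ) + (b : ℝ)) * ρ ^ 2 + (a : ℝ) * (b : ℝ) * ρ - 1 = 0)
    (hmax : ∀ x : ℝ, x ^ 3 - ((a : ℝ) + (b : ℝ)) * x ^ 2 + (a : ℝ) * (b : ℝ) * x - 1 = 0 → x ≤ ρ)
    (hdeg : Module.finrank ℚ ℚ⟮ρ⟯ = 3)
    (v w : ℤ) (hv0 : 0 ≤ v) (hv1 : v ≤ b - a - 1) (hw0 : v * a ≤ w) (hw1 : w ≤ (v + 1) * a - 1) :
    IsLeast {q : ℚ | ∃ δ ∈ CodifferentPlus (Algebra.adjoin ℤ {AdjoinSimple.gen ℚ ρ}),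
        Algebra.trace ℚ ℚ⟮ρ⟯
          ((-((v : ℤ) : ℚ⟮ρ⟯)
            + ((b * w + 1 : ℤ) : ℚ⟮ρ⟯) * AdjoinSimple.gen ℚ ρ
            - ((w : ℤ) : ℚ⟮ρ⟯) * AdjoinSimple.gen ℚ ρ ^ 2) * δ) = q}
      ((min (b - a - v + 1) (w - a * v + 1) : ℤ) : ℚ) := by
  have hA : (2 : ℝ) ≤ a := by exact_mod_cast ha
  have hAB : (a : ℝ) ≤ b - 2 := by exact_mod_cast hab
  obtain ⟨⟨B, hB⟩, hemb⟩ := exists_setup a b ρ hroot hdeg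
  have hγK : AdjoinSimple.gen ℚ ρ ^ 3 = ((a + b : ℤ) : ℚ⟮ρ⟯) * AdjoinSimple.gen ℚ ρ ^ 2
      - ((a * b : ℤ) : ℚ⟮ρ⟯) * AdjoinSimple.gen ℚ ρ + 1 := by
    apply Subtype.ext
    push_cast
    simp only [AdjoinSimple.coe_gen]
    linear_combination hroot
  have key : ∀ (γ : ℚ⟮ρ⟯) (_ : AdjoinSimple.gen ℚ ρ = γ) (δ : ℚ⟮ρ⟯) (t0 t1 t2 : ℤ),
      Algebra.trace ℚ ℚ⟮ρ⟯ δ = t0 → Algebra.trace ℚ ℚ⟮ρ⟯ (γ * δ) = t1 →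
      Algebra.trace ℚ ℚ⟮ρ⟯ (γ ^ 2 * δ) = t2 →
      Algebra.trace ℚ ℚ⟮ρ⟯ ((-((v : ℤ) : ℚ⟮ρ⟯) + ((b * w + 1 : ℤ) : ℚ⟮ρ⟯) * γ
            - ((w : ℤ) : ℚ⟮ρ⟯) * γ ^ 2) * δ)
        = ((-v * t0 + (b * w + 1) * t1 - w * t2 : ℤ) : ℚ) := by
    intro γ _ δ t0 t1 t2 h0 h1 h2
    have : (-((v : ℤ) : ℚ⟮ρ⟯) + ((b * w + 1 : ℤ) : ℚ⟮ρ⟯) * γ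
            - ((w : ℤ) : ℚ⟮ρ⟯) * γ ^ 2) * δ
        = (-v) • δ + (b * w + 1) • (γ * δ) - w • (γ ^ 2 * δ) := by
      simp only [zsmul_eq_mul]; push_cast; ring
    rw [this, map_sub, map_add, map_zsmul, map_zsmul, map_zsmul, h0, h1, h2]
    simp
  generalize hg : AdjoinSimple.gen ℚ ρ = γ at *
  replace key := key γ rfl
  have hγQ : γ ^ 3 = ((a : ℚ) + b) • γ ^ 2 - ((a : ℚ) * b) • γ + 1 := by
    rw [hγK]
    simp only [Algebra.smul_def]
    push_cast
    simp
  have hroots : ∀ φ : ℚ⟮ρ⟯ →+* ℝ,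
      φ γ ^ 3 - ((a : ℝ) + (b : ℝ)) * φ γ ^ 2 + (a : ℝ) * (b : ℝ) * φ γ - 1 = 0 := by
    intro φ
    have := congrArg φ hγK
    simp only [map_add, map_sub, map_mul, map_pow, map_one, map_intCast] at this
    push_cast at this
    linear_combination this
  have hform : ∀ (δ : ℚ⟮ρ⟯) (t0 t1 t2 : ℤ), Algebra.trace ℚ ℚ⟮ρ⟯ δ = t0 →
      Algebra.trace ℚ ℚ⟮ρ⟯ (γ * δ) = t1 → Algebra.trace ℚ ℚ⟮ρ⟯ (γ ^ 2 * δ) = t2 →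
      ∀ φ : ℚ⟮ρ⟯ →+* ℝ, φ δ * (3 * φ γ ^ 2 - 2 * (a + b) * φ γ + a * b) =
        t2 + (φ γ - (a + b)) * t1 + (φ γ ^ 2 - (a + b) * φ γ + a * b) * t0 := by
    intro δ t0 t1 t2 h0 h1 h2 φ
    have := embedding_formula B γ hB _ _ hγQ δ t0 t1 t2 h0 h1 h2 φ
    push_cast at this
    exact this
  constructor
  · -- attained
    have fin : ∀ t0 t1 t2 : ℤ, (∀ r d : ℝ,
        r ^ 3 - ((a : ℝ) + (b : ℝ)) * r ^ 2 + (a : ℝ) * (b : ℝ) * r - 1 = 0 →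
        d * (3 * r ^ 2 - 2 * (a + b) * r + a * b) =
          t2 + (r - (a + b)) * t1 + (r ^ 2 - (a + b) * r + a * b) * t0 → 0 < d) →
        ∃ δ ∈ CodifferentPlus (Algebra.adjoin ℤ {γ}),
        Algebra.trace ℚ ℚ⟮ρ⟯ ((-((v : ℤ) : ℚ⟮ρ⟯) + ((b * w + 1 : ℤ) : ℚ⟮ρ⟯) * γ
            - ((w : ℤ) : ℚ⟮ρ⟯) * γ ^ 2) * δ)
        = ((-v * t0 + (b * w + 1) * t1 - w * t2 : ℤ) : ℚ) := by
      intro t0 t1 t2 hpos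
      obtain ⟨δ, h0, h1, h2⟩ := exists_of_traces B γ hB t0 t1 t2
      refine ⟨δ, ⟨fun φ => hpos _ _ (hroots φ) (hform δ t0 t1 t2 h0 h1 h2 φ), ?_⟩,
        key δ t0 t1 t2 h0 h1 h2⟩
      exact mem_codiff γ (a + b) (a * b) hγK δ t0 t1 t2 h0 h1 h2
    rcases le_total (b - a - v + 1) (w - a * v + 1) with hle | hle
    · rw [min_eq_left hle]
      obtain ⟨δ, hδ, e⟩ := fin 1 (b - a + 1) (b * (b - a + 1)) (by
        intro r d hr hd
        push_cast at hd
        exact pos_two a b r d hA hAB hr hd)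
      refine ⟨δ, hδ, e.trans ?_⟩
      congr 1
      ring
    · rw [min_eq_right hle]
      obtain ⟨δ, hδ, e⟩ := fin a 1 (b - 1) (by
        intro r d hr hd
        push_cast at hd
        exact pos_one a b r d hA hAB hr hd)
      refine ⟨δ, hδ, e.trans ?_⟩
      congr 1
      ring
  · -- lower bound
    rintro q ⟨δ, ⟨hpos, hint⟩, rfl⟩
    have hγmem : γ ∈ Algebra.adjoin ℤ {γ} := Algebra.self_mem_adjoin_singleton ℤ γ
    obtain ⟨t0, h0⟩ := hint 1 (one_mem _)
    obtain ⟨t1, h1⟩ := hint γ hγmem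
    obtain ⟨t2, h2⟩ := hint (γ ^ 2) (pow_mem hγmem 2)
    rw [one_mul] at h0
    rw [key δ t0 t1 t2 h0 h1 h2]
    obtain ⟨r, r', r'', b1, ⟨b2, b3⟩, ⟨b4, b5⟩, f1, f2, f3⟩ := exists_roots a b hA hAB
    obtain ⟨φ, rfl⟩ := hemb r f1
    obtain ⟨φ', rfl⟩ := hemb r' f2
    obtain ⟨φ'', rfl⟩ := hemb r'' f3
    have hsum := fun x => trace_sum B γ hB _ _ hγQ x φ φ' φ''
      (by linarith) (by linarith) (by linarith)
    have p1 := hpos φ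
    have p2 := hpos φ'
    have p3 := hpos φ''
    have ht0 : 0 < t0 := by
      have := hsum δ
      rw [h0] at this
      push_cast at this
      have h : (0 : ℝ) < t0 := by rw [this]; positivity
      exact_mod_cast h
    have ht1 : 0 < t1 := by
      have := hsum (γ * δ)
      rw [h1, map_mul, map_mul, map_mul] at this
      push_cast at this
      have q1 : 0 < φ γ := by linarith
      have q2 : 0 < φ' γ := by linarith
      have h : (0 : ℝ) < t1 := by rw [this]; positivity
      exact_mod_cast h
    have hE := hform δ t0 t1 t2 h0 h1 h2 φ'
    have hf : 3 * φ' γ ^ 2 - 2 * ((a : ℝ) + b) * φ' γ + a * b < 0 := by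
      rcases root_cases a b (φ' γ) hA hAB f2 with ⟨h, _⟩ | ⟨_, _, h⟩ | ⟨_, h, _⟩
      · linarith
      · exact h
      · linarith
    have hneg := mul_neg_of_pos_of_neg p2 hf
    rw [hE] at hneg
    exact_mod_cast lower_bound a b v w t0 t1 t2 ha hab hv0 hv1 hw0 hw1 (φ' γ) b2 b3 f2 ht0 ht1 hneg
end
end

section
/- Let a, b be rational integers with 2 ≤ a ≤ b−2 and let ρ be the largest real root of x³ − (a+b)x² + abx − 1. If α is indecomposable in ℤ[ρ], then the minimum of Tr_{K/ℚ}(αδ) over all δ ∈ ℤ[ρ]^{∨,+} is at most min{b − a + 1, a}. -/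
open IntermediateField

noncomputable section

/-- `r` is a real root of the polynomial `x (x - a) (x - a - d) - 1`. -/
def IsRt (a d : ℤ) (r : ℝ) : Prop := r * (r - a) * (r - a - d) = 1

/-- Value at `r` of the element with coordinates `(x, y, z)` in the basis `1, r, r (r - a)`. -/
def evl (a : ℤ) (x y z : ℤ) (r : ℝ) : ℝ := x + y * r + z * (r * (r - a))

def TPt (a d x y z : ℤ) : Prop := ∀ r : ℝ, IsRt a d r → 0 < evl a x y z r

def Indt (a d x y z : ℤ) : Prop :=
  TPt a d x y z ∧ ∀ x1 y1 z1 : ℤ, TPt a d x1 y1 z1 → ¬ TPt a d (x - x1) (y - y1) (z - z1)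

/-- derivative at a root -/
def fder (a d : ℤ) (r : ℝ) : ℝ := (r - a) * (r - a - d) + r * (r - a - d) + r * (r - a)

/-- numerator of the codifferent element attached to the functional `t` -/
def gnum (a d t0 t1 t2 : ℤ) (r : ℝ) : ℝ := t0 * ((r - a) * (r - a - d)) + t1 * (r - a - d) + t2

def DualPos (a d t0 t1 t2 : ℤ) : Prop :=
  ∀ r : ℝ, IsRt a d r → 0 < gnum a d t0 t1 t2 r * fder a d r

def Pt (a d x y z : ℤ) : Prop :=
  ∃ t0 t1 t2 : ℤ, DualPos a d t0 t1 t2 ∧ t0 * x + t1 * y + t2 * z ≤ min (d + 1) a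

section core
variable {a d : ℤ}

lemma IsRt.pos (ha : 2 ≤ a) (hd : 2 ≤ d) {r : ℝ} (h : IsRt a d r) : 0 < r := by
  have ha' : (2 : ℝ) ≤ a := by exact_mod_cast ha
  have hd' : (2 : ℝ) ≤ d := by exact_mod_cast hd
  by_contra hr
  push Not at hr
  unfold IsRt at h
  have : 0 ≤ (r - a) * (r - a - d) := mul_nonneg_of_nonpos_of_nonpos (by linarith) (by linarith)
  nlinarith

lemma IsRt.ne (_ha : 2 ≤ a) (_hd : 2 ≤ d) {r : ℝ} (h : IsRt a d r) : 0 < (r - a) ^ 2 := by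
  have : r - a ≠ 0 := by
    intro h0
    unfold IsRt at h
    rw [h0] at h
    simp at h
  positivity

/-- three cases for a root -/
lemma IsRt.cases (ha : 2 ≤ a) (hd : 2 ≤ d) {r : ℝ} (h : IsRt a d r) :
    (a + d < r) ∨ (a - 1 < r ∧ r < a) ∨ (0 < r ∧ r < 1) := by
  have ha' : (2 : ℝ) ≤ a := by exact_mod_cast ha
  have hd' : (2 : ℝ) ≤ d := by exact_mod_cast hd
  have h0 := h.pos ha hd
  unfold IsRt at h
  by_contra hc
  push Not at hc
  obtain ⟨h1, h2, h3⟩ := hc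
  have h3 := h3 h0
  by_cases hra : r < a
  · have h4 : r ≤ a - 1 := by
      by_contra h5
      push Not at h5
      linarith [h2 h5]
    have : 1 ≤ r * (a - r) := by nlinarith
    have : r * (a - r) * (a + d - r) = 1 := by linarith
    nlinarith
  · push Not at hra
    have : 0 ≤ r * (r - a) := mul_nonneg h0.le (by linarith)
    nlinarith

lemma fder_pos_of_gt (ha : 2 ≤ a) (hd : 2 ≤ d) {r : ℝ} (h : (a : ℝ) + d < r) :
    0 < fder a d r := by
  have ha' : (2 : ℝ) ≤ a := by exact_mod_cast ha
  have hd' : (2 : ℝ) ≤ d := by exact_mod_cast hd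
  unfold fder
  have h1 : 0 < r - a - d := by linarith
  have h2 : 0 < r - a := by linarith
  have h3 : 0 < r := by linarith
  positivity

lemma fder_neg_of_mid (ha : 2 ≤ a) (hd : 2 ≤ d) {r : ℝ} (hr : IsRt a d r)
    (h : (a : ℝ) - 1 < r) (h' : r < a) : fder a d r < 0 := by
  have ha' : (2 : ℝ) ≤ a := by exact_mod_cast ha
  have hd' : (2 : ℝ) ≤ d := by exact_mod_cast hd
  unfold fder
  unfold IsRt at hr
  have h1 : (r - a) * (r - a - d) ≤ 1 := by
    have : 0 < (a - r) * (a + d - r) := mul_pos (by linarith) (by linarith)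
    nlinarith
  have h2 : 0 < r * (a - r) := mul_pos (by linarith) (by linarith)
  nlinarith

lemma small_facts (ha : 2 ≤ a) (hd : 2 ≤ d) {r : ℝ} (hr : IsRt a d r)
    (h : 0 < r) (h' : r < 1) : r * (a + d - r) < 1 ∧ r * (a - r) < 1 := by
  have ha' : (2 : ℝ) ≤ a := by exact_mod_cast ha
  have hd' : (2 : ℝ) ≤ d := by exact_mod_cast hd
  unfold IsRt at hr
  have h1 : 0 < r * (a + d - r) := mul_pos h (by linarith)
  have h2 : 0 < r * (a - r) := mul_pos h (by linarith)
  constructor <;> nlinarith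

lemma fder_pos_of_small (ha : 2 ≤ a) (hd : 2 ≤ d) {r : ℝ} (hr : IsRt a d r)
    (h : 0 < r) (h' : r < 1) : 0 < fder a d r := by
  have ha' : (2 : ℝ) ≤ a := by exact_mod_cast ha
  have hd' : (2 : ℝ) ≤ d := by exact_mod_cast hd
  obtain ⟨h1, h2⟩ := small_facts ha hd hr h h'
  unfold fder
  have : 0 < (a - r - 1) * (a + d - r) := mul_pos (by linarith) (by linarith)
  nlinarith

lemma dualA (ha : 2 ≤ a) (hd : 2 ≤ d) : DualPos a d 1 (a - 1) 0 := by
  have ha' : (2 : ℝ) ≤ a := by exact_mod_cast ha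
  have hd' : (2 : ℝ) ≤ d := by exact_mod_cast hd
  intro r hr
  have hg : gnum a d 1 (a - 1) 0 r = (r - 1) * (r - a - d) := by
    unfold gnum; push_cast; ring
  rw [hg]
  rcases hr.cases ha hd with h | ⟨h, h'⟩ | ⟨h, h'⟩
  · exact mul_pos (mul_pos (by linarith) (by linarith)) (fder_pos_of_gt ha hd h)
  · exact mul_pos_of_neg_of_neg (mul_neg_of_pos_of_neg (by linarith) (by linarith))
      (fder_neg_of_mid ha hd hr h h')
  · exact mul_pos (mul_pos_of_neg_of_neg (by linarith) (by linarith))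
      (fder_pos_of_small ha hd hr h h')

lemma dualB (ha : 2 ≤ a) (hd : 2 ≤ d) : DualPos a d 1 a 1 := by
  have ha' : (2 : ℝ) ≤ a := by exact_mod_cast ha
  have hd' : (2 : ℝ) ≤ d := by exact_mod_cast hd
  intro r hr
  have hg : gnum a d 1 a 1 r = r * (r - a - d) + 1 := by
    unfold gnum; push_cast; ring
  rw [hg]
  rcases hr.cases ha hd with h | ⟨h, h'⟩ | ⟨h, h'⟩
  · refine mul_pos ?_ (fder_pos_of_gt ha hd h)
    have : 0 < r * (r - a - d) := mul_pos (by linarith) (by linarith)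
    linarith
  · refine mul_pos_of_neg_of_neg ?_ (fder_neg_of_mid ha hd hr h h')
    nlinarith
  · refine mul_pos ?_ (fder_pos_of_small ha hd hr h h')
    have := (small_facts ha hd hr h h').1
    linarith

/-! ### The four unit actions -/

lemma evl_M {r : ℝ} (hr : IsRt a d r) (x y z : ℤ) :
    evl a z (x + a * y) (y + (a + d) * z) r = r * evl a x y z r := by
  unfold evl; unfold IsRt at hr
  push_cast
  linear_combination (-(z : ℝ)) * hr

lemma evl_N {r : ℝ} (hr : IsRt a d r) (x y z : ℤ) :
    evl a (z - a * x) x (y + d * z) r = (r - a) * evl a x y z r := by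
  unfold evl; unfold IsRt at hr
  push_cast
  linear_combination (-(z : ℝ)) * hr

lemma tp_M (ha : 2 ≤ a) (hd : 2 ≤ d) {x y z : ℤ} :
    TPt a d z (x + a * y) (y + (a + d) * z) ↔ TPt a d x y z := by
  constructor
  · intro h r hr
    have h1 := h r hr
    rw [evl_M hr] at h1
    exact (pos_iff_pos_of_mul_pos h1).1 (hr.pos ha hd)
  · intro h r hr
    rw [evl_M hr]
    exact mul_pos (hr.pos ha hd) (h r hr)

lemma tp_E (ha : 2 ≤ a) (hd : 2 ≤ d) {x y z : ℤ} :
    TPt a d (y + d * z - a * (z - a * x)) (z - a * x) (x + d * (y + d * z)) ↔ TPt a d x y z := by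
  have key : ∀ r, IsRt a d r →
      evl a (y + d * z - a * (z - a * x)) (z - a * x) (x + d * (y + d * z)) r
        = (r - a) ^ 2 * evl a x y z r := by
    intro r hr
    rw [evl_N hr, evl_N hr]; ring
  constructor
  · intro h r hr
    have h1 := h r hr
    rw [key r hr] at h1
    exact (pos_iff_pos_of_mul_pos h1).1 (hr.ne ha hd)
  · intro h r hr
    rw [key r hr]
    exact mul_pos (hr.ne ha hd) (h r hr)

lemma tp_Mi (ha : 2 ≤ a) (hd : 2 ≤ d) {x y z : ℤ} :
    TPt a d (y - a * z + a * (a + d) * x) (z - (a + d) * x) x ↔ TPt a d x y z := by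
  rw [← tp_M ha hd]
  have e1 : y - a * z + a * (a + d) * x + a * (z - (a + d) * x) = y := by ring
  have e2 : z - (a + d) * x + (a + d) * x = z := by ring
  rw [e1, e2]

/-- coordinates of the inverse of multiplication by `(r - a)^2` -/
lemma tp_Ei (ha : 2 ≤ a) (hd : 2 ≤ d) {x y z : ℤ} :
    TPt a d (z - d * x - a * d * y) (x + a * y - d * y - a * d * (z - d * x - a * d * y))
      (y + a * (z - d * x - a * d * y)) ↔ TPt a d x y z := by
  rw [← tp_E ha hd]
  congr! 1 <;> ring

lemma ind_M (ha : 2 ≤ a) (hd : 2 ≤ d) {x y z : ℤ} (h : Indt a d x y z) :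
    Indt a d z (x + a * y) (y + (a + d) * z) := by
  refine ⟨(tp_M ha hd).2 h.1, fun x1 y1 z1 h1 h2 => ?_⟩
  refine h.2 _ _ _ ((tp_Mi ha hd).2 h1) ?_
  rw [← tp_M ha hd]
  convert h2 using 1 <;> ring

lemma ind_Mi (ha : 2 ≤ a) (hd : 2 ≤ d) {x y z : ℤ} (h : Indt a d x y z) :
    Indt a d (y - a * z + a * (a + d) * x) (z - (a + d) * x) x := by
  refine ⟨(tp_Mi ha hd).2 h.1, fun x1 y1 z1 h1 h2 => ?_⟩
  refine h.2 _ _ _ ((tp_M ha hd).2 h1) ?_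
  rw [← tp_Mi ha hd]
  convert h2 using 1 <;> ring

lemma ind_E (ha : 2 ≤ a) (hd : 2 ≤ d) {x y z : ℤ} (h : Indt a d x y z) :
    Indt a d (y + d * z - a * (z - a * x)) (z - a * x) (x + d * (y + d * z)) := by
  refine ⟨(tp_E ha hd).2 h.1, fun x1 y1 z1 h1 h2 => ?_⟩
  refine h.2 _ _ _ ((tp_Ei ha hd).2 h1) ?_
  rw [← tp_E ha hd]
  convert h2 using 1 <;> ring

lemma ind_Ei (ha : 2 ≤ a) (hd : 2 ≤ d) {x y z : ℤ} (h : Indt a d x y z) :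
    Indt a d (z - d * x - a * d * y) (x + a * y - d * y - a * d * (z - d * x - a * d * y))
      (y + a * (z - d * x - a * d * y)) := by
  refine ⟨(tp_Ei ha hd).2 h.1, fun x1 y1 z1 h1 h2 => ?_⟩
  refine h.2 _ _ _ ((tp_E ha hd).2 h1) ?_
  rw [← tp_Ei ha hd]
  convert h2 using 1 <;> ring

lemma gnum_M {r : ℝ} (hr : IsRt a d r) (t0 t1 t2 : ℤ) :
    gnum a d t1 (a * t1 + t2) (t0 + (a + d) * t2) r = r * gnum a d t0 t1 t2 r := by
  unfold gnum; unfold IsRt at hr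
  push_cast
  linear_combination (-(t0 : ℝ)) * hr

lemma gnum_N {r : ℝ} (hr : IsRt a d r) (t0 t1 t2 : ℤ) :
    gnum a d (t1 - a * t0) t2 (t0 + d * t2) r = (r - a) * gnum a d t0 t1 t2 r := by
  unfold gnum; unfold IsRt at hr
  push_cast
  linear_combination (-(t0 : ℝ)) * hr

lemma dual_M (ha : 2 ≤ a) (hd : 2 ≤ d) {t0 t1 t2 : ℤ} :
    DualPos a d t1 (a * t1 + t2) (t0 + (a + d) * t2) ↔ DualPos a d t0 t1 t2 := by
  constructor
  · intro h r hr
    have h1 := h r hr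
    rw [gnum_M hr, mul_assoc] at h1
    exact (pos_iff_pos_of_mul_pos h1).1 (hr.pos ha hd)
  · intro h r hr
    rw [gnum_M hr, mul_assoc]
    exact mul_pos (hr.pos ha hd) (h r hr)

lemma dual_E (ha : 2 ≤ a) (hd : 2 ≤ d) {t0 t1 t2 : ℤ} :
    DualPos a d (t2 - a * (t1 - a * t0)) (t0 + d * t2) (t1 - a * t0 + d * (t0 + d * t2)) ↔
      DualPos a d t0 t1 t2 := by
  have key : ∀ r, IsRt a d r →
      gnum a d (t2 - a * (t1 - a * t0)) (t0 + d * t2) (t1 - a * t0 + d * (t0 + d * t2)) r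
        = (r - a) ^ 2 * gnum a d t0 t1 t2 r := by
    intro r hr
    rw [gnum_N hr, gnum_N hr]; ring
  constructor
  · intro h r hr
    have h1 := h r hr
    rw [key r hr, mul_assoc] at h1
    exact (pos_iff_pos_of_mul_pos h1).1 (hr.ne ha hd)
  · intro h r hr
    rw [key r hr, mul_assoc]
    exact mul_pos (hr.ne ha hd) (h r hr)

lemma pt_M (ha : 2 ≤ a) (hd : 2 ≤ d) {x y z : ℤ}
    (h : Pt a d z (x + a * y) (y + (a + d) * z)) : Pt a d x y z := by
  obtain ⟨t0, t1, t2, h1, h2⟩ := h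
  exact ⟨_, _, _, (dual_M ha hd).2 h1, le_trans (le_of_eq (by ring)) h2⟩

lemma pt_E (ha : 2 ≤ a) (hd : 2 ≤ d) {x y z : ℤ}
    (h : Pt a d (y + d * z - a * (z - a * x)) (z - a * x) (x + d * (y + d * z))) :
    Pt a d x y z := by
  obtain ⟨t0, t1, t2, h1, h2⟩ := h
  exact ⟨_, _, _, (dual_E ha hd).2 h1, le_trans (le_of_eq (by ring)) h2⟩

lemma pt_M' (ha : 2 ≤ a) (hd : 2 ≤ d) {x y z : ℤ}
    (h : Pt a d x y z) : Pt a d z (x + a * y) (y + (a + d) * z) := by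
  obtain ⟨t0, t1, t2, h1, h2⟩ := h
  refine ⟨t2 - (a + d) * (t1 - a * t0), t0, t1 - a * t0, ?_, le_trans (le_of_eq (by ring)) h2⟩
  rw [← dual_M ha hd]
  convert h1 using 1 <;> ring

lemma pt_E' (ha : 2 ≤ a) (hd : 2 ≤ d) {x y z : ℤ} (h : Pt a d x y z) :
    Pt a d (y + d * z - a * (z - a * x)) (z - a * x) (x + d * (y + d * z)) := by
  obtain ⟨t0, t1, t2, h1, h2⟩ := h
  refine ⟨t1 - d * (t0 + a * (t2 - d * t1)),
    t2 - d * t1 + a * (t1 - d * (t0 + a * (t2 - d * t1))), t0 + a * (t2 - d * t1), ?_,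
    le_trans (le_of_eq (by ring)) h2⟩
  rw [← dual_E ha hd]
  convert h1 using 1 <;> ring

lemma pt_Mi (ha : 2 ≤ a) (hd : 2 ≤ d) {x y z : ℤ}
    (h : Pt a d (y - a * z + a * (a + d) * x) (z - (a + d) * x) x) : Pt a d x y z := by
  have := pt_M' ha hd h
  convert this using 1 <;> ring

lemma pt_Ei (ha : 2 ≤ a) (hd : 2 ≤ d) {x y z : ℤ}
    (h : Pt a d (z - d * x - a * d * y) (x + a * y - d * y - a * d * (z - d * x - a * d * y))
      (y + a * (z - d * x - a * d * y))) : Pt a d x y z := by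
  have := pt_E' ha hd h
  convert this using 1 <;> ring

end core

section core2
variable {a d : ℤ}

lemma exists_roots_s15 (ha : 2 ≤ a) (hd : 2 ≤ d) : ∃ r1 r2 r3 : ℝ,
    IsRt a d r1 ∧ IsRt a d r2 ∧ IsRt a d r3 ∧ (a : ℝ) + d < r1 ∧ r1 < a + d + 1 ∧
      (a : ℝ) - 1 < r2 ∧ r2 < a ∧ 0 < r3 ∧ r3 < 1 := by
  have ha' : (2 : ℝ) ≤ a := by exact_mod_cast ha
  have hd' : (2 : ℝ) ≤ d := by exact_mod_cast hd
  have hc : Continuous (fun r : ℝ => r * (r - a) * (r - a - d)) := by fun_prop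
  have h1 := intermediate_value_Ioo (a := (a : ℝ) + d) (b := a + d + 1) (by linarith)
    hc.continuousOn
  have h2 := intermediate_value_Ioo' (a := (a : ℝ) - 1) (b := a) (by linarith) hc.continuousOn
  have h3 := intermediate_value_Ioo (a := (0 : ℝ)) (b := 1) (by linarith) hc.continuousOn
  obtain ⟨r1, ⟨h11, h12⟩, h13⟩ := h1 (show (1 : ℝ) ∈ _ by
    constructor
    · simp
    · nlinarith)
  obtain ⟨r2, ⟨h21, h22⟩, h23⟩ := h2 (show (1 : ℝ) ∈ _ by
    constructor
    · simp
    · nlinarith)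
  obtain ⟨r3, ⟨h31, h32⟩, h33⟩ := h3 (show (1 : ℝ) ∈ _ by
    constructor
    · simp
    · nlinarith)
  exact ⟨r1, r2, r3, h13, h23, h33, h11, h12, h21, h22, h31, h32⟩

lemma T_pos (ha : 2 ≤ a) (hd : 2 ≤ d) {x y z : ℤ} (h : TPt a d x y z) : 0 < x + a * y + z := by
  have ha' : (2 : ℝ) ≤ a := by exact_mod_cast ha
  have hd' : (2 : ℝ) ≤ d := by exact_mod_cast hd
  obtain ⟨r1, r2, r3, e1, e2, e3, h1, h1', h2, h2', h3, h3'⟩ := exists_roots_s15 ha hd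
  have p1 := h r1 e1
  have p2 := h r2 e2
  have p3 := h r3 e3
  have d12 : 0 < r1 - r2 := by linarith
  have d13 : 0 < r1 - r3 := by linarith
  have d23 : 0 < r2 - r3 := by linarith
  have w1 : 0 < ((a - r2) * (a - r3) + 1) / ((r1 - r2) * (r1 - r3)) := by
    have : 0 < (a - r2) * (a - r3) := mul_pos (by linarith) (by linarith)
    positivity
  have w2 : 0 < ((r1 - a) * (a - r3) - 1) / ((r1 - r2) * (r2 - r3)) := by
    have : 0 < (r1 - a) * (a - r3) - 1 := by nlinarith
    positivity
  have w3 : 0 < (1 - (r1 - a) * (a - r2)) / ((r1 - r3) * (r2 - r3)) := by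
    have : 0 < 1 - (r1 - a) * (a - r2) := by
      unfold IsRt at e2
      set s := (a : ℝ) - r2 with hs
      have hs0 : 0 < s := by linarith
      have hs1 : s < 1 := by linarith
      have e2' : s * ((a - s) * (d + s)) = 1 := by
        rw [← e2, hs]; ring
      have hs2 : s < 1 / 2 := by
        by_contra hcon
        push Not at hcon
        have : (2 : ℝ) < (a - s) * (d + s) := by nlinarith
        nlinarith
      have : d + 1 < (a - s) * (d + s) := by nlinarith
      nlinarith
    positivity
  have key : ((x + a * y + z : ℤ) : ℝ) =
      ((a - r2) * (a - r3) + 1) / ((r1 - r2) * (r1 - r3)) * evl a x y z r1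
      + ((r1 - a) * (a - r3) - 1) / ((r1 - r2) * (r2 - r3)) * evl a x y z r2
      + (1 - (r1 - a) * (a - r2)) / ((r1 - r3) * (r2 - r3)) * evl a x y z r3 := by
    unfold evl
    push_cast
    field_simp
    ring
  have : (0 : ℝ) < ((x + a * y + z : ℤ) : ℝ) := by rw [key]; positivity
  exact_mod_cast this

lemma x_pos (ha : 2 ≤ a) (hd : 2 ≤ d) {x : ℤ} (h : TPt a d x 0 0) : 0 < x := by
  have := T_pos ha hd h
  simpa using this

/-- nonzero nonnegative combinations of `1, ρ, η` are totally positive -/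
lemma tp_cone1 (ha : 2 ≤ a) (hd : 2 ≤ d) {x y z : ℤ} (hy : 0 ≤ y) (hz : 0 ≤ z)
    (hx : 0 ≤ d * x - z) (hne : ¬ (x = 0 ∧ y = 0 ∧ z = 0)) : TPt a d x y z := by
  intro r hr
  have hr0 := hr.pos ha hd
  have hr1 := hr.ne ha hd
  have hd' : (2 : ℝ) ≤ d := by exact_mod_cast hd
  have key : d * evl a x y z r =
      ((d * x - z : ℤ) : ℝ) + d * y * r + z * (r * (r - a) ^ 2) := by
    unfold evl; unfold IsRt at hr
    push_cast
    linear_combination (-(z : ℝ)) * hr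
  have hy' : (0 : ℝ) ≤ y := by exact_mod_cast hy
  have hz' : (0 : ℝ) ≤ z := by exact_mod_cast hz
  have hx' : (0 : ℝ) ≤ ((d * x - z : ℤ) : ℝ) := by exact_mod_cast hx
  have : 0 < d * evl a x y z r := by
    rw [key]
    rcases hz.lt_or_eq with h | h
    · have : (0 : ℝ) < z := by exact_mod_cast h
      positivity
    rcases hy.lt_or_eq with h1 | h1
    · have : (0 : ℝ) < y := by exact_mod_cast h1
      positivity
    have h2 : 0 < d * x - z := by
      rcases hx.lt_or_eq with h2 | h2
      · exact h2
      · exfalso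
        apply hne
        refine ⟨?_, h1.symm, h.symm⟩
        subst h
        have : d * x = 0 := by linarith
        rcases mul_eq_zero.1 this with h3 | h3
        · omega
        · exact h3
    have : (0 : ℝ) < ((d * x - z : ℤ) : ℝ) := by exact_mod_cast h2
    positivity
  exact (pos_iff_pos_of_mul_pos this).1 (by linarith)

/-- nonzero nonnegative combinations of `1, ε, η` are totally positive -/
lemma tp_cone2 (ha : 2 ≤ a) (hd : 2 ≤ d) {x y z : ℤ} (hy : y ≤ 0) (hz : 0 ≤ a * z + y)
    (hx : 0 ≤ a * d * x + a ^ 2 * d * y - a * z - y) (hne : ¬ (x = 0 ∧ y = 0 ∧ z = 0)) :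
    TPt a d x y z := by
  rcases hy.lt_or_eq with hy0 | hy0
  · intro r hr
    have hr0 := hr.pos ha hd
    have hr1 := hr.ne ha hd
    have hd' : (2 : ℝ) ≤ d := by exact_mod_cast hd
    have ha' : (2 : ℝ) ≤ a := by exact_mod_cast ha
    have key : (a * d) * evl a x y z r =
        ((a * d * x + a ^ 2 * d * y - a * z - y : ℤ) : ℝ) + d * (-y) * (r - a) ^ 2
          + ((a * z + y : ℤ) : ℝ) * (r * (r - a) ^ 2) := by
      unfold evl; unfold IsRt at hr
      push_cast
      linear_combination (-(a * z + y : ℝ)) * hr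
    have hy' : (0 : ℝ) < -y := by
      have : (y : ℝ) < 0 := by exact_mod_cast hy0
      linarith
    have hz' : (0 : ℝ) ≤ ((a * z + y : ℤ) : ℝ) := by exact_mod_cast hz
    have hx' : (0 : ℝ) ≤ ((a * d * x + a ^ 2 * d * y - a * z - y : ℤ) : ℝ) := by exact_mod_cast hx
    have : 0 < (a * d) * evl a x y z r := by
      rw [key]
      positivity
    exact (pos_iff_pos_of_mul_pos this).1 (by positivity)
  · subst hy0
    refine tp_cone1 ha hd le_rfl ?_ ?_ hne
    · by_contra hcon
      nlinarith
    · by_contra hcon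
      nlinarith

lemma pt_one (ha : 2 ≤ a) (hd : 2 ≤ d) : Pt a d 1 0 0 :=
  ⟨1, a - 1, 0, dualA ha hd, by simp; omega⟩

lemma ind_not (x1 y1 z1 : ℤ) {x y z : ℤ} (h : Indt a d x y z)
    (h1 : TPt a d x1 y1 z1) (h2 : TPt a d (x - x1) (y - y1) (z - z1)) : False :=
  h.2 _ _ _ h1 h2

lemma cone1 (ha : 2 ≤ a) (hd : 2 ≤ d) {x y z : ℤ} (hy : 0 ≤ y) (hz : 0 ≤ z)
    (hx : 0 ≤ d * x - z) (h : Indt a d x y z) : Pt a d x y z := by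
  rcases hy.lt_or_eq with hy0 | hy0
  · -- the element minus `ρ` stays in the cone
    by_cases h0 : x = 0 ∧ y = 1 ∧ z = 0
    · obtain ⟨rfl, rfl, rfl⟩ := h0
      have := pt_M' ha hd (pt_one ha hd)
      simpa using this
    · exfalso
      refine ind_not 0 1 0 h (tp_cone1 ha hd (by norm_num) (by norm_num) (by norm_num) (by norm_num)) ?_
      refine tp_cone1 ha hd (by omega) (by omega) (by simpa using hx) ?_
      omega
  · subst hy0
    refine ⟨1, a - 1, 0, dualA ha hd, ?_⟩
    have hx1 : x ≤ 1 := by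
      by_contra hx2
      push Not at hx2
      refine ind_not 1 0 (min z d) h (tp_cone1 ha hd le_rfl (by omega) (by omega) (by omega)) ?_
      refine tp_cone1 ha hd (by omega) (by omega) ?_ (by omega)
      rcases le_total z d with h3 | h3
      · rw [min_eq_left h3]; nlinarith
      · rw [min_eq_right h3]; nlinarith
    simp only [mul_zero, zero_mul, add_zero, one_mul]
    omega

lemma cone2 (ha : 2 ≤ a) (hd : 2 ≤ d) {x y z : ℤ} (hy : y ≤ 0) (hz : 0 ≤ a * z + y)
    (hx : 0 ≤ a * d * x + a ^ 2 * d * y - a * z - y) (h : Indt a d x y z) : Pt a d x y z := by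
  have had : 0 < a * d := by positivity
  by_cases hya : y ≤ -a
  · by_cases h0 : x = a ^ 2 ∧ y = -a ∧ z = 1
    · obtain ⟨rfl, rfl, rfl⟩ := h0
      have := pt_E' ha hd (pt_one ha hd)
      convert this using 1 <;> ring
    · exfalso
      refine ind_not (a ^ 2) (-a) 1 h
        (tp_cone2 ha hd (by omega) (by linarith) (le_of_eq (by ring)) (by omega)) ?_
      refine tp_cone2 ha hd (by linarith) (by linarith) (le_trans hx (le_of_eq (by ring))) ?_
      omega
  push Not at hya
  rcases hy.lt_or_eq with hy0 | hy0
  · have hzd : z ≤ d := by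
      by_contra hcon
      push Not at hcon
      refine ind_not 1 0 d h (tp_cone1 ha hd le_rfl (by omega) (by omega) (by omega)) ?_
      exact tp_cone2 ha hd (by omega) (by nlinarith) (le_trans hx (le_of_eq (by ring))) (by omega)
    have hx1 : x + a * y ≤ 1 := by
      by_contra hcon
      push Not at hcon
      refine ind_not 1 0 0 h (tp_cone1 ha hd le_rfl (by omega) (by omega) (by omega)) ?_
      refine tp_cone2 ha hd (by omega) (by linarith) ?_ (by omega)
      nlinarith
    rcases le_total (d + 1) a with h1 | h1
    · refine ⟨1, a, 1, dualB ha hd, ?_⟩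
      rw [min_eq_left h1]; linarith
    · refine ⟨1, a - 1, 0, dualA ha hd, ?_⟩
      rw [min_eq_right h1]; linarith
  · subst hy0
    refine cone1 ha hd le_rfl ?_ ?_ h
    · by_contra hcon
      nlinarith
    · by_contra hcon
      nlinarith

end core2

section core3
variable {a d : ℤ}

set_option maxHeartbeats 4000000 in
lemma covering (ha : 2 ≤ a) (hd : 2 ≤ d) {x y z : ℤ}
    (hpos : y = 0 → z = 0 → 0 < x)
    (hM : x + a * y + z ≤ z + a * (x + a * y) + (y + (a + d) * z))
    (hMi : x + a * y + z ≤ (y - a * z + a * (a + d) * x) + a * (z - (a + d) * x) + x)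
    (hE : x + a * y + z ≤
      (y + d * z - a * (z - a * x)) + a * (z - a * x) + (x + d * (y + d * z)))
    (hEi : x + a * y + z ≤ (z - d * x - a * d * y)
      + a * (x + a * y - d * y - a * d * (z - d * x - a * d * y))
      + (y + a * (z - d * x - a * d * y)))
    (hH : x + a * y + z ≤ (x + d * (y + d * z)) + a * (y + d * z)
      + (z - a * x + (a + d) * (x + d * (y + d * z))))
    (hHi : x + a * y + z ≤ (x - d * y) + a * (y - d * (z - d * x - a * d * y))
      + (z - d * x - a * d * y)) :
    (0 ≤ y ∧ 0 ≤ z ∧ 0 ≤ d * x - z) ∨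
    (y ≤ 0 ∧ 0 ≤ a * z + y ∧ 0 ≤ a * d * x + a ^ 2 * d * y - a * z - y) ∨
    (0 ≤ x + a * y ∧ 0 ≤ y + (a + d) * z ∧ 0 ≤ d * z - (y + (a + d) * z)) ∨
    (x + a * y ≤ 0 ∧ 0 ≤ a * (y + (a + d) * z) + (x + a * y) ∧
      0 ≤ a * d * z + a ^ 2 * d * (x + a * y) - a * (y + (a + d) * z) - (x + a * y)) ∨
    (0 ≤ y + d * z ∧ 0 ≤ z - a * x + (a + d) * (x + d * (y + d * z)) ∧
      0 ≤ d * (x + d * (y + d * z)) - (z - a * x + (a + d) * (x + d * (y + d * z)))) ∨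
    (y + d * z ≤ 0 ∧ 0 ≤ a * (z - a * x + (a + d) * (x + d * (y + d * z))) + (y + d * z) ∧
      0 ≤ a * d * (x + d * (y + d * z)) + a ^ 2 * d * (y + d * z)
        - a * (z - a * x + (a + d) * (x + d * (y + d * z))) - (y + d * z)) ∨
    (z - a * x ≤ 0 ∧ 0 ≤ a * (x + d * (y + d * z)) + (z - a * x) ∧
      0 ≤ a * d * (y + d * z - a * (z - a * x)) + a ^ 2 * d * (z - a * x)
        - a * (x + d * (y + d * z)) - (z - a * x)) := by
  have ha0 : 0 ≤ a - 1 := by linarith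
  have hd0 : 0 < d := by linarith
  have had : 0 < a * d := by positivity
  have hK : 0 < a * d - 1 := by nlinarith
  have s4 : y + d * z ≤ 0 → y + (a + d) * z ≤ 0 →
      (y + d * z ≤ 0 ∧ 0 ≤ a * (z - a * x + (a + d) * (x + d * (y + d * z))) + (y + d * z) ∧
      0 ≤ a * d * (x + d * (y + d * z)) + a ^ 2 * d * (y + d * z)
        - a * (z - a * x + (a + d) * (x + d * (y + d * z))) - (y + d * z)) := by
    intro h1 h2
    refine ⟨h1, ?_, by linarith⟩
    by_contra hc
    push Not at hc
    have e1 : 0 ≤ d * (a * d - 1) * -(y + (a + d) * z) := by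
      apply mul_nonneg (by positivity) (by linarith)
    have e2 : 0 < d * -(a * (z - a * x + (a + d) * (x + d * (y + d * z))) + (y + d * z)) :=
      mul_pos hd0 (by linarith)
    have e3 := mul_le_mul_of_nonneg_left hH had.le
    linarith
  rcases le_or_gt 0 y with hy | hy
  · rcases le_or_gt 0 z with hz | hz
    · -- sector 1
      left
      refine ⟨hy, hz, ?_⟩
      by_contra hc
      push Not at hc
      have h1 : (a - 1) * y + z ≤ 0 := by linarith
      have h2 : 0 ≤ (a - 1) * y := by positivity
      have hz0 : z = 0 := by linarith
      have hy0 : y = 0 := by nlinarith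
      have := hpos hy0 hz0
      subst hz0
      nlinarith
    · rcases le_or_gt 0 (a * d * y + (1 + a * d ^ 2) * z) with hp | hp
      · -- sector 6
        have hc : 0 ≤ a * x - z := by
          by_contra hc
          push Not at hc
          have e : a * d * ((y - a * z + a * (a + d) * x) + a * (z - (a + d) * x) + x
              - (x + a * y + z)) = (1 - a) * (a * d * y + (1 + a * d ^ 2) * z)
              + (-z) * (1 + a * d ^ 2 - d - (-d + a + a ^ 2 * d ^ 2 - a * d)) := by ring
          have h1 : 0 ≤ (a - 1) * (a * d * y + (1 + a * d ^ 2) * z) := mul_nonneg ha0 hp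
          have h2 : 0 < (-z) * ((-d + a + a ^ 2 * d ^ 2 - a * d) - (1 + a * d ^ 2 - d)) := by
            apply mul_pos (by linarith)
            have : 0 ≤ a * d ^ 2 * (a - 2) := mul_nonneg (by positivity) (by linarith)
            have : 0 < a * d * (d - 1) := mul_pos had (by linarith)
            nlinarith
          have h3 : 0 ≤ a * d * ((y - a * z + a * (a + d) * x) + a * (z - (a + d) * x) + x
              - (x + a * y + z)) := mul_nonneg had.le (by linarith)
          nlinarith
        right; right; right; right; right; right
        refine ⟨by linarith, ?_, ?_⟩
        · nlinarith
        · nlinarith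
      · rcases le_or_gt 0 (y + d * z) with hq | hq
        · -- sector 5
          have hc : 0 ≤ d * x + ((1 + a * d ^ 2) * z + a * d * y) + d * (d * (y + d * z)) := by
            by_contra hc
            push Not at hc
            have h1 : 0 ≤ d * (y + d * z) * (-d + a + a ^ 2 * d ^ 2 - a * d - 1) := by
              apply mul_nonneg (by positivity)
              have : 0 ≤ a * d * (a * d - 2) := mul_nonneg had.le (by nlinarith)
              nlinarith
            have h2 : 0 < -((1 + a * d ^ 2) * z + a * d * y) * (a * d ^ 2 - d) := by
              apply mul_pos (by linarith)
              nlinarith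
            have h3 := mul_le_mul_of_nonneg_left hE hd0.le
            nlinarith
          right; right; right; right; left
          refine ⟨hq, ?_, ?_⟩
          · nlinarith
          · nlinarith
        · right; right; right; right; right; left
          exact s4 hq.le (by nlinarith)
  · rcases le_or_gt 0 (a * z + y) with h1 | h1
    · -- sector 2
      right; left
      refine ⟨hy.le, h1, ?_⟩
      by_contra hc
      push Not at hc
      have e1 : 0 ≤ d * (a * z + y) := by positivity
      have e2 : 0 < (a * d - 1) * d * -(a * d * x + a ^ 2 * d * y - a * z - y) := by
        apply mul_pos (by positivity) (by linarith)
      have e3 := mul_le_mul_of_nonneg_left hHi had.le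
      linarith
    · rcases le_or_gt 0 (y + (a + d) * z) with h2 | h2
      · -- sector 3
        rcases le_or_gt 0 (x + a * y) with h3 | h3
        · right; right; left
          exact ⟨h3, h2, by nlinarith⟩
        · right; right; right; left
          refine ⟨h3.le, by nlinarith, ?_⟩
          have e3 := mul_le_mul_of_nonneg_left hEi hd0.le
          have e4 : 0 ≤ d * ((a * d - 1) * -(a * z + y)
            + (x + a * y) * (a ^ 2 * d ^ 2 - a * d - d + a - 1)) := by nlinarith
          have e5 := nonneg_of_mul_nonneg_right e4 hd0
          have e6 : 0 ≤ (a ^ 2 - a - 1) * -(x + a * y) :=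
            mul_nonneg (by nlinarith) (by linarith)
          have e7 : 0 ≤ (a * d - 1) * (a * d * z + a ^ 2 * d * (x + a * y)
              - a * (y + (a + d) * z) - (x + a * y)) := by nlinarith
          exact nonneg_of_mul_nonneg_right e7 hK
      · right; right; right; right; right; left
        refine s4 ?_ h2.le
        rcases le_or_gt 0 z with h3 | h3 <;> nlinarith

lemma main_triple_aux (ha : 2 ≤ a) (hd : 2 ≤ d) (n : ℕ) : ∀ x y z : ℤ, Indt a d x y z →
    x + a * y + z ≤ n → Pt a d x y z := by
  induction n with
  | zero =>
    intro x y z h hn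
    have := T_pos ha hd h.1
    push_cast at hn
    omega
  | succ n ih =>
    intro x y z h hn
    push_cast at hn
    have iM := ind_M ha hd h
    have iMi := ind_Mi ha hd h
    have iE := ind_E ha hd h
    have iEi := ind_Ei ha hd h
    have iH : Indt a d (x + d * (y + d * z)) (y + d * z)
        (z - a * x + (a + d) * (x + d * (y + d * z))) := by
      convert ind_M ha hd iE using 1; ring
    have iHi : Indt a d (x - d * y) (y - d * (z - d * x - a * d * y))
        (z - d * x - a * d * y) := by
      convert ind_Mi ha hd iEi using 1 <;> ring
    have pH : Pt a d (x + d * (y + d * z)) (y + d * z)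
        (z - a * x + (a + d) * (x + d * (y + d * z))) → Pt a d x y z := by
      intro hp
      apply pt_E ha hd
      apply pt_M ha hd
      convert hp using 1; ring
    have pHi : Pt a d (x - d * y) (y - d * (z - d * x - a * d * y))
        (z - d * x - a * d * y) → Pt a d x y z := by
      intro hp
      apply pt_Ei ha hd
      apply pt_Mi ha hd
      convert hp using 1 <;> ring
    by_cases hM : x + a * y + z ≤ z + a * (x + a * y) + (y + (a + d) * z)
    swap
    · exact pt_M ha hd (ih _ _ _ iM (by omega))
    by_cases hMi : x + a * y + z ≤ (y - a * z + a * (a + d) * x) + a * (z - (a + d) * x) + x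
    swap
    · exact pt_Mi ha hd (ih _ _ _ iMi (by omega))
    by_cases hE : x + a * y + z ≤
      (y + d * z - a * (z - a * x)) + a * (z - a * x) + (x + d * (y + d * z))
    swap
    · exact pt_E ha hd (ih _ _ _ iE (by omega))
    by_cases hEi : x + a * y + z ≤ (z - d * x - a * d * y)
      + a * (x + a * y - d * y - a * d * (z - d * x - a * d * y))
      + (y + a * (z - d * x - a * d * y))
    swap
    · exact pt_Ei ha hd (ih _ _ _ iEi (by omega))
    by_cases hH : x + a * y + z ≤ (x + d * (y + d * z)) + a * (y + d * z)
      + (z - a * x + (a + d) * (x + d * (y + d * z)))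
    swap
    · exact pH (ih _ _ _ iH (by omega))
    by_cases hHi : x + a * y + z ≤ (x - d * y) + a * (y - d * (z - d * x - a * d * y))
      + (z - d * x - a * d * y)
    swap
    · exact pHi (ih _ _ _ iHi (by omega))
    have hpos : y = 0 → z = 0 → 0 < x := by
      rintro rfl rfl
      exact x_pos ha hd h.1
    rcases covering ha hd hpos hM hMi hE hEi hH hHi with ⟨h1, h2, h3⟩ | ⟨h1, h2, h3⟩ |
      ⟨h1, h2, h3⟩ | ⟨h1, h2, h3⟩ | ⟨h1, h2, h3⟩ | ⟨h1, h2, h3⟩ | ⟨h1, h2, h3⟩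
    · exact cone1 ha hd h1 h2 h3 h
    · exact cone2 ha hd h1 h2 h3 h
    · exact pt_M ha hd (cone1 ha hd h1 h2 h3 iM)
    · exact pt_M ha hd (cone2 ha hd h1 h2 h3 iM)
    · exact pH (cone1 ha hd h1 h2 h3 iH)
    · exact pH (cone2 ha hd h1 h2 h3 iH)
    · exact pt_E ha hd (cone2 ha hd h1 h2 h3 iE)

lemma main_triple (ha : 2 ≤ a) (hd : 2 ≤ d) {x y z : ℤ} (h : Indt a d x y z) :
    Pt a d x y z :=
  main_triple_aux ha hd (x + a * y + z).toNat x y z h (Int.self_le_toNat _)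

end core3

section field
open Polynomial

variable {K : Type*} [Field K] [Algebra ℚ K]

/-- The element of `K` with coordinates `(x, y, z)`. -/
def elt (a : ℤ) (ρ : K) (x y z : ℤ) : K := x + y * ρ + z * (ρ * (ρ - a))

lemma mem_adjoin_iff {a d : ℤ} {ρ : K} (hρ : ρ * (ρ - a) * (ρ - a - d) = 1) (α : K) :
    α ∈ Algebra.adjoin ℤ {ρ} ↔ ∃ x y z : ℤ, α = elt a ρ x y z := by
  constructor
  · intro h
    induction h using Algebra.adjoin_induction with
    | mem x hx =>
      obtain rfl : x = ρ := hx
      exact ⟨0, 1, 0, by simp [elt]⟩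
    | algebraMap r => exact ⟨r, 0, 0, by simp [elt]⟩
    | add x y _ _ hx hy =>
      obtain ⟨x1, y1, z1, rfl⟩ := hx
      obtain ⟨x2, y2, z2, rfl⟩ := hy
      exact ⟨x1 + x2, y1 + y2, z1 + z2, by unfold elt; push_cast; ring⟩
    | mul x y _ _ hx hy =>
      obtain ⟨x1, y1, z1, rfl⟩ := hx
      obtain ⟨x2, y2, z2, rfl⟩ := hy
      refine ⟨x1 * x2 + y1 * z2 + z1 * y2 + d * (z1 * z2),
        x1 * y2 + y1 * x2 + a * (y1 * y2) + z1 * z2,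
        x1 * z2 + z1 * x2 + y1 * y2 + (a + d) * (y1 * z2 + z1 * y2)
          + (a + d) * d * (z1 * z2), ?_⟩
      unfold elt
      push_cast
      linear_combination ((y1 : K) * z2 + z1 * y2 + z1 * z2 * (ρ + d)) * hρ
  · rintro ⟨x, y, z, rfl⟩
    have h := Algebra.self_mem_adjoin_singleton ℤ ρ
    have hi : ∀ n : ℤ, (n : K) ∈ Algebra.adjoin ℤ {ρ} := fun n => intCast_mem _ n
    unfold elt
    exact add_mem (add_mem (hi x) (mul_mem (hi y) h))
      (mul_mem (hi z) (mul_mem h (sub_mem h (hi a))))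

/-- The codifferent element attached to the functional `t`. -/
def dlt (a d : ℤ) (ρ : K) (t0 t1 t2 : ℤ) : K :=
  (t0 * ((ρ - a) * (ρ - a - d)) + t1 * (ρ - a - d) + t2) /
    ((ρ - a) * (ρ - a - d) + ρ * (ρ - a - d) + ρ * (ρ - a))

/-- the defining polynomial -/
def fpol (a d : ℤ) : ℚ[X] := X ^ 3 - C (2 * a + d : ℚ) * X ^ 2 + C (a * (a + d) : ℚ) * X - C 1

lemma coeff_fpol_one (a d : ℤ) : (fpol a d).coeff 1 = a * (a + d) := by
  simp only [fpol, coeff_sub, coeff_add, coeff_C_mul, coeff_X_pow, coeff_X, coeff_C]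
  norm_num

lemma coeff_fpol_two (a d : ℤ) : (fpol a d).coeff 2 = -(2 * a + d) := by
  simp only [fpol, coeff_sub, coeff_add, coeff_C_mul, coeff_X_pow, coeff_X, coeff_C]
  norm_num

lemma coeff_fpol_three (a d : ℤ) : (fpol a d).coeff 3 = 1 := by
  simp only [fpol, coeff_sub, coeff_add, coeff_C_mul, coeff_X_pow, coeff_X, coeff_C]
  norm_num

lemma trace_dlt [FiniteDimensional ℚ K] {a d : ℤ} (pb : PowerBasis ℚ K)
    (hdim : pb.dim = 3) (hmin : minpoly ℚ pb.gen = fpol a d) (t0 t1 t2 x y z : ℤ) :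
    Algebra.trace ℚ K (elt a pb.gen x y z * dlt a d pb.gen t0 t1 t2)
      = ((t0 * x + t1 * y + t2 * z : ℤ) : ℚ) := by
  set ρ := pb.gen with hρ
  have hder : aeval ρ (derivative (minpoly ℚ ρ)) =
      (ρ - a) * (ρ - a - d) + ρ * (ρ - a - d) + ρ * (ρ - a) := by
    rw [hmin, fpol]
    simp
    ring
  have hc3 : (minpolyDiv ℚ ρ).coeff 3 = 0 := by
    apply coeff_eq_zero_of_natDegree_lt
    refine (natDegree_minpolyDiv_lt (Algebra.IsIntegral.isIntegral ρ)).trans_le ?_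
    rw [hmin, fpol]
    compute_degree
  have hc2 : (minpolyDiv ℚ ρ).coeff 2 = 1 := by
    rw [coeff_minpolyDiv, hc3, hmin, coeff_fpol_three]
    simp
  have hc1 : (minpolyDiv ℚ ρ).coeff 1 = ρ - a - a - d := by
    rw [coeff_minpolyDiv, hc2, hmin, coeff_fpol_two]
    simp only [map_neg, map_mul, map_add, map_intCast, map_ofNat]
    ring
  have hc0 : (minpolyDiv ℚ ρ).coeff 0 = (ρ - a) * (ρ - a - d) := by
    rw [coeff_minpolyDiv, hc1, hmin, coeff_fpol_one]
    simp only [map_neg, map_mul, map_add, map_intCast, map_ofNat]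
    ring
  have i0 : 0 < pb.dim := by omega
  have i1 : 1 < pb.dim := by omega
  have i2 : 2 < pb.dim := by omega
  set D := (ρ - a) * (ρ - a - d) + ρ * (ρ - a - d) + ρ * (ρ - a) with hD
  have key : ∀ i j : Fin pb.dim, Algebra.trace ℚ K
      (ρ ^ (i : ℕ) * ((minpolyDiv ℚ ρ).coeff j / D)) = if i = j then 1 else 0 := by
    intro i j
    rw [← hder, hρ, ← Module.Basis.traceDual_powerBasis_eq, ← pb.basis_eq_pow]
    exact Module.Basis.trace_mul_traceDual _ i j
  have k00 := key ⟨0, i0⟩ ⟨0, i0⟩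
  have k01 := key ⟨0, i0⟩ ⟨1, i1⟩
  have k02 := key ⟨0, i0⟩ ⟨2, i2⟩
  have k10 := key ⟨1, i1⟩ ⟨0, i0⟩
  have k11 := key ⟨1, i1⟩ ⟨1, i1⟩
  have k12 := key ⟨1, i1⟩ ⟨2, i2⟩
  have k20 := key ⟨2, i2⟩ ⟨0, i0⟩
  have k21 := key ⟨2, i2⟩ ⟨1, i1⟩
  have k22 := key ⟨2, i2⟩ ⟨2, i2⟩
  simp only [hc0, hc1, hc2, Fin.mk.injEq, if_true] at k00 k01 k02 k10 k11 k12 k20 k21 k22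
  norm_num only [if_false] at k01 k02 k10 k12 k20 k21
  have hexp : elt a ρ x y z * dlt a d ρ t0 t1 t2 =
      (x * t0 : ℚ) • (ρ ^ 0 * ((ρ - a) * (ρ - a - d) / D))
      + (x * t1 : ℚ) • (ρ ^ 0 * ((ρ - a - a - d) / D))
      + (x * (t2 + a * t1) : ℚ) • (ρ ^ 0 * (1 / D))
      + ((y - a * z) * t0 : ℚ) • (ρ ^ 1 * ((ρ - a) * (ρ - a - d) / D))
      + ((y - a * z) * t1 : ℚ) • (ρ ^ 1 * ((ρ - a - a - d) / D))
      + ((y - a * z) * (t2 + a * t1) : ℚ) • (ρ ^ 1 * (1 / D))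
      + (z * t0 : ℚ) • (ρ ^ 2 * ((ρ - a) * (ρ - a - d) / D))
      + (z * t1 : ℚ) • (ρ ^ 2 * ((ρ - a - a - d) / D))
      + (z * (t2 + a * t1) : ℚ) • (ρ ^ 2 * (1 / D)) := by
    unfold elt dlt
    rw [← hD]
    simp only [Algebra.smul_def]
    push_cast [map_mul, map_add, map_sub, map_intCast]
    ring
  rw [hexp]
  simp only [map_add, map_smul, k00, k01, k02, k10, k11, k12, k20, k21, k22]
  simp
  ring

lemma main_field [FiniteDimensional ℚ K] {a d : ℤ} (ha : 2 ≤ a) (hd : 2 ≤ d)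
    (pb : PowerBasis ℚ K)
    (hdim : pb.dim = 3) (hmin : minpoly ℚ pb.gen = fpol a d) (α : K)
    (hind : IsIndecomposableIn (Algebra.adjoin ℤ {pb.gen}) α) :
    ∃ δ ∈ CodifferentPlus (Algebra.adjoin ℤ {pb.gen}),
      Algebra.trace ℚ K (α * δ) ≤ ((min (d + 1) a : ℤ) : ℚ) := by
  have hρ : pb.gen * (pb.gen - a) * (pb.gen - a - d) = 1 := by
    have h := minpoly.aeval ℚ pb.gen
    rw [hmin, fpol] at h
    simp at h
    linear_combination h
  have hroot : ∀ φ : K →+* ℝ, IsRt a d (φ pb.gen) := by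
    intro φ
    have := congrArg φ hρ
    simpa [IsRt] using this
  have hemb : ∀ r, IsRt a d r → ∃ φ : K →+* ℝ, φ pb.gen = r := by
    intro r hr
    refine ⟨(pb.lift r ?_).toRingHom, pb.lift_gen r _⟩
    rw [hmin, fpol]
    unfold IsRt at hr
    simp
    linear_combination hr
  have hev : ∀ (φ : K →+* ℝ) (x y z : ℤ),
      φ (elt a pb.gen x y z) = evl a x y z (φ pb.gen) := by
    intro φ x y z
    simp [elt, evl]
  have htp : ∀ x y z : ℤ, TotallyPositive (elt a pb.gen x y z) ↔ TPt a d x y z := by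
    intro x y z
    constructor
    · intro h r hr
      obtain ⟨φ, rfl⟩ := hemb r hr
      rw [← hev]; exact h φ
    · intro h φ
      rw [hev]; exact h _ (hroot φ)
  obtain ⟨hmem, hpos, hdec⟩ := hind
  obtain ⟨x, y, z, rfl⟩ := (mem_adjoin_iff hρ α).1 hmem
  have hI : Indt a d x y z := by
    refine ⟨(htp _ _ _).1 hpos, fun x1 y1 z1 h1 h2 => hdec ?_⟩
    refine ⟨_, _, (mem_adjoin_iff hρ _).2 ⟨x1, y1, z1, rfl⟩,
      (mem_adjoin_iff hρ _).2 ⟨x - x1, y - y1, z - z1, rfl⟩, (htp _ _ _).2 h1,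
      (htp _ _ _).2 h2, ?_⟩
    unfold elt; push_cast; ring
  obtain ⟨t0, t1, t2, ht, hle⟩ := main_triple ha hd hI
  refine ⟨dlt a d pb.gen t0 t1 t2, ⟨?_, ?_⟩, ?_⟩
  · intro φ
    have h := ht _ (hroot φ)
    have e : φ (dlt a d pb.gen t0 t1 t2) =
        gnum a d t0 t1 t2 (φ pb.gen) / fder a d (φ pb.gen) := by
      simp [dlt, gnum, fder]
    rw [e]
    rw [div_eq_mul_inv]
    rcases mul_pos_iff.1 h with ⟨h1, h2⟩ | ⟨h1, h2⟩
    · exact mul_pos h1 (inv_pos.2 h2)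
    · exact mul_pos_of_neg_of_neg h1 (inv_lt_zero.2 h2)
  · intro β hβ
    obtain ⟨x', y', z', rfl⟩ := (mem_adjoin_iff hρ β).1 hβ
    exact ⟨_, trace_dlt pb hdim hmin _ _ _ _ _ _⟩
  · rw [trace_dlt pb hdim hmin]
    exact_mod_cast hle

end field

/-- Let `2 ≤ a ≤ b−2` and `ρ` the largest real root of
`x³ − (a+b)x² + abx − 1`. If `α` is indecomposable in `ℤ[ρ]`, then the minimum of
`Tr_{K/ℚ}(αδ)` over all `δ ∈ ℤ[ρ]^{∨,+}` is at most `min{b − a + 1, a}`. -/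
theorem stmt_15 (a b : ℤ) (ha : 2 ≤ a) (hab : a ≤ b - 2)
    (ρ : ℝ) (hroot : ρ ^ 3 - ((a : ℝ) + (b : ℝ)) * ρ ^ 2 + (a : ℝ) * (b : ℝ) * ρ - 1 = 0)
    (hmax : ∀ x : ℝ, x ^ 3 - ((a : ℝ) + (b : ℝ)) * x ^ 2 + (a : ℝ) * (b : ℝ) * x - 1 = 0 → x ≤ ρ)
    (hdeg : Module.finrank ℚ ℚ⟮ρ⟯ = 3)
    (α : ℚ⟮ρ⟯)
    (hind : IsIndecomposableIn (Algebra.adjoin ℤ {AdjoinSimple.gen ℚ ρ}) α) :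
    ∃ δ ∈ CodifferentPlus (Algebra.adjoin ℤ {AdjoinSimple.gen ℚ ρ}),
      Algebra.trace ℚ ℚ⟮ρ⟯ (α * δ) ≤ ((min (b - a + 1) a : ℤ) : ℚ) := by
  have hmonic : (fpol a (b - a)).Monic := by
    unfold fpol
    monicity!
  have hnd : (fpol a (b - a)).natDegree = 3 := by
    unfold fpol
    compute_degree!
  have haev : Polynomial.aeval ρ (fpol a (b - a)) = 0 := by
    unfold fpol
    simp
    linear_combination hroot
  have hint : IsIntegral ℚ ρ := ⟨_, hmonic, haev⟩
  have hdeg' : (minpoly ℚ ρ).natDegree = 3 := by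
    rw [← IntermediateField.adjoin.finrank hint, hdeg]
  have hmin : minpoly ℚ ρ = fpol a (b - a) :=
    (Polynomial.eq_of_monic_of_dvd_of_natDegree_le (minpoly.monic hint) hmonic
      (minpoly.dvd ℚ ρ haev) (by omega)).symm
  have : FiniteDimensional ℚ ℚ⟮ρ⟯ := IntermediateField.adjoin.finiteDimensional hint
  have := main_field ha (show 2 ≤ b - a by omega) (IntermediateField.adjoin.powerBasis hint)
    hdeg' (by rw [IntermediateField.adjoin.powerBasis_gen, IntermediateField.minpoly_gen, hmin]) α
    (by rw [IntermediateField.adjoin.powerBasis_gen]; exact hind)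
  rw [IntermediateField.adjoin.powerBasis_gen] at this
  exact this
end
end

section
/- Let a, b be rational integers with 2 ≤ a ≤ b−2 and (a,b) ≠ (2,4), and write b − a = 2L + l₀ with L a nonnegative integer and l₀ ∈ {0,1}. If α is indecomposable in ℤ[ρ], then: (1) if l₀ = 0 and 1 ≤ L ≤ a−2, then N_{K/ℚ}(α) ≤ L²a³ + (2L³ + L² + 1)a² − (2L³ + 3L² + L)a + L³ + L²; (2) if l₀ = 1 and 1 ≤ L ≤ a+1, then N_{K/ℚ}(α) ≤ (L² + L)a³ + (2L³ + 4L² + 3L + 3)a² − (2L³ + 6L² + 5L + 3)a + L³ + 3L² + 2L + 1. -/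
open IntermediateField

noncomputable section

/-! ### The norm form and the polynomial inequality -/

/-- The norm of `1 + (ρ - a) (Z ρ - y)` where `c = b - a`. -/
def nf (a c Z y : ℤ) : ℤ :=
  1 + (a * Z - y) * (c - a) + Z * (a * a + c * c) - (a * Z - y) ^ 2 * a * c
    + (a * Z - y) * Z * (-a * c * (c - a) - 3) + Z * Z * (a * a * c * c - 2 * (c - a))
    + (a * Z - y) ^ 3 + (a * Z - y) ^ 2 * Z * (c - a) - (a * Z - y) * Z * Z * a * c + Z ^ 3

/-- A concave quadratic is nonnegative on an interval if it is so at the end points. -/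
lemma concave_nonneg (p q k u v x : ℤ) (hk : 0 ≤ k) (hux : u ≤ x) (hxv : x ≤ v)
    (hu : 0 ≤ p + q * u - k * u ^ 2) (hv : 0 ≤ p + q * v - k * v ^ 2) :
    0 ≤ p + q * x - k * x ^ 2 := by
  rcases eq_or_lt_of_le hux with h | h
  · rw [← h]; exact hu
  have h1 : 0 < v - u := by linarith
  have h2 : (v - u) * (p + q * x - k * x ^ 2)
      = (v - x) * (p + q * u - k * u ^ 2) + (x - u) * (p + q * v - k * v ^ 2)
        + k * ((v - x) * (x - u) * (v - u)) := by ring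
  have h3 : 0 ≤ (v - u) * (p + q * x - k * x ^ 2) := by
    rw [h2]
    have := mul_nonneg (mul_nonneg (sub_nonneg.2 hxv) (sub_nonneg.2 hux)) h1.le
    have e1 := mul_nonneg (sub_nonneg.2 hxv) hu
    have e2 := mul_nonneg (sub_nonneg.2 hux) hv
    have e3 := mul_nonneg hk this
    linarith
  exact nonneg_of_mul_nonneg_right h3 h1

lemma nf_mono_y (a c Z y : ℤ) (ha : 2 ≤ a) (hc : 2 ≤ c) (hZ : 2 ≤ Z) (hZc : Z ≤ c)
    (hy : 0 ≤ y) (hya : y ≤ a - 1) : nf a c Z y ≤ nf a c Z (a - 1) := by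
  obtain ⟨A, ha'⟩ : ∃ A, a = A + 2 := ⟨a - 2, by ring⟩
  obtain ⟨C, hc'⟩ : ∃ C, c = C + 2 := ⟨c - 2, by ring⟩
  have hA : 0 ≤ A := by linarith
  have hC : 0 ≤ C := by linarith
  have key : 0 ≤ (-2*a^2*c + 2*a*c - 3*a^2 + 7*a - c - 3
      + (a*c^2 + a^2*c + 2*a*c + 4*a^2 - 4*a - 2*c + 3) * Z - (a*c + a^2) * Z^2)
      + (a*c + 3*a - 3 - (2*a + c) * Z) * (a - 1 - y) - 1 * (a - 1 - y) ^ 2 := by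
    apply concave_nonneg _ _ 1 0 (a - 1) (a - 1 - y) (by norm_num) (by linarith) (by linarith)
    · have := concave_nonneg (-2*a^2*c + 2*a*c - 3*a^2 + 7*a - c - 3)
        (a*c^2 + a^2*c + 2*a*c + 4*a^2 - 4*a - 2*c + 3) (a*c + a^2) 2 c Z
        (by positivity) hZ hZc
        (by rw [ha', hc']; ring_nf; positivity) (by rw [ha', hc']; ring_nf; positivity)
      linarith
    · have := concave_nonneg (-2*a^2*c + 2*a*c - 3*a^2 + 7*a - c - 3 
          + (a*c + 3*a - 3) * (a - 1) - (a - 1) ^ 2)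
        (a*c^2 + a^2*c + 2*a*c + 4*a^2 - 4*a - 2*c + 3 - (2*a + c) * (a - 1)) (a*c + a^2) 2 c Z
        (by positivity) hZ hZc
        (by rw [ha', hc']; ring_nf; positivity) (by rw [ha', hc']; ring_nf; positivity)
      linarith
  have h2 := mul_nonneg (sub_nonneg.2 hya) key
  have h3 : nf a c Z (a - 1) - nf a c Z y = (a - 1 - y) * ((-2*a^2*c + 2*a*c - 3*a^2 + 7*a - c - 3
      + (a*c^2 + a^2*c + 2*a*c + 4*a^2 - 4*a - 2*c + 3) * Z - (a*c + a^2) * Z^2)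
      + (a*c + 3*a - 3 - (2*a + c) * Z) * (a - 1 - y) - 1 * (a - 1 - y) ^ 2) := by
    unfold nf; ring
  linarith

lemma nf_top_even (a L Z : ℤ) (hL : 1 ≤ L) (hLa : L ≤ a - 2) (hZ : 0 ≤ Z)
    (hZc : Z ≤ 2 * L) : nf a (2 * L) Z (a - 1) ≤ nf a (2 * L) (L + 1) (a - 1) := by
  obtain ⟨u, rfl⟩ : ∃ u, Z = L + 1 + u := ⟨Z - L - 1, by ring⟩
  have h : nf a (2 * L) (L + 1) (a - 1) - nf a (2 * L) (L + 1 + u) (a - 1) =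
      u * ((L^2 - 3*a + (2*L + 2)*a^2) + (L - 3 + (1 - 2*L)*a + (2*L - 1)*a^2 + a^3) * u - u^2) := by
    unfold nf; ring
  obtain ⟨A, hA⟩ : ∃ A, a = L + 2 + A := ⟨a - 2 - L, by ring⟩
  obtain ⟨M, hM⟩ : ∃ M, L = M + 1 := ⟨L - 1, by ring⟩
  have hA0 : 0 ≤ A := by linarith
  have hM0 : 0 ≤ M := by linarith
  have e2 : 2 * L ≤ L - 3 + (1 - 2*L)*a + (2*L - 1)*a^2 + a^3 := by
    rw [hA, hM]; rw [← sub_nonneg]; ring_nf; positivity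
  have e1 : 0 ≤ (L^2 - 3*a + (2*L + 2)*a^2) := by
    rw [hA, hM]; ring_nf; positivity
  have e3 : 0 ≤ (L - 3 + (1 - 2*L)*a + (2*L - 1)*a^2 + a^3) + 1 - (L^2 - 3*a + (2*L + 2)*a^2) := by
    rw [hA, hM]; ring_nf; positivity
  suffices 0 ≤ u * ((L^2 - 3*a + (2*L + 2)*a^2)
      + (L - 3 + (1 - 2*L)*a + (2*L - 1)*a^2 + a^3) * u - u^2) by linarith
  generalize (L^2 - 3*a + (2*L + 2)*a^2) = A1 at *
  generalize (L - 3 + (1 - 2*L)*a + (2*L - 1)*a^2 + a^3) = A2 at *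
  rcases lt_trichotomy u 0 with h0 | h0 | h0
  · apply mul_nonneg_of_nonpos_of_nonpos h0.le
    nlinarith
  · simp [h0]
  · apply mul_nonneg h0.le
    nlinarith

lemma nf_top_odd (a L Z : ℤ) (ha : 2 ≤ a) (hL : 1 ≤ L) (hLa : L ≤ a + 1) (hZ : 0 ≤ Z)
    (hZc : Z ≤ 2 * L + 1) : nf a (2 * L + 1) Z (a - 1) ≤ nf a (2 * L + 1) (L + 1) (a - 1) := by
  obtain ⟨u, rfl⟩ : ∃ u, Z = L + 1 + u := ⟨Z - L - 1, by ring⟩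
  have h : nf a (2 * L + 1) (L + 1) (a - 1) - nf a (2 * L + 1) (L + 1 + u) (a - 1) =
      u * ((L^2 + 2 + (2*L - 3)*a + 3*a^2 - a^3) + (L - 1 - 2*L*a + 2*L*a^2 + a^3) * u - u^2) := by
    unfold nf; ring
  obtain ⟨A, hA⟩ : ∃ A, a = 2 + A := ⟨a - 2, by ring⟩
  obtain ⟨M, hM⟩ : ∃ M, L = M + 1 := ⟨L - 1, by ring⟩
  have hA0 : 0 ≤ A := by linarith
  have hM0 : 0 ≤ M := by linarith
  have e2 : L + 1 ≤ (L - 1 - 2*L*a + 2*L*a^2 + a^3) := by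
    rw [hA, hM]; rw [← sub_nonneg]; ring_nf; positivity
  have e1 : 0 ≤ (L - 1 - 2*L*a + 2*L*a^2 + a^3) + (L^2 + 2 + (2*L - 3)*a + 3*a^2 - a^3) - 1 := by
    rw [hA, hM]; ring_nf; positivity
  have e3 : 0 ≤ (L - 1 - 2*L*a + 2*L*a^2 + a^3) + 1 - (L^2 + 2 + (2*L - 3)*a + 3*a^2 - a^3) := by
    have h1 : 0 ≤ (a + 1 - L) * (a + L) := mul_nonneg (by linarith) (by linarith)
    have h2 : 0 ≤ 2 * a ^ 3 - 4 * a ^ 2 + 2 * a - 2 := by rw [hA]; ring_nf; positivity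
    have h3 : 0 ≤ L * a * (a - 2) := mul_nonneg (by positivity) (by linarith)
    nlinarith
  suffices 0 ≤ u * ((L^2 + 2 + (2*L - 3)*a + 3*a^2 - a^3)
      + (L - 1 - 2*L*a + 2*L*a^2 + a^3) * u - u^2) by linarith
  generalize (L^2 + 2 + (2*L - 3)*a + 3*a^2 - a^3) = A1 at *
  generalize (L - 1 - 2*L*a + 2*L*a^2 + a^3) = A2 at *
  rcases lt_trichotomy u 0 with h0 | h0 | h0
  · apply mul_nonneg_of_nonpos_of_nonpos h0.le
    nlinarith
  · simp [h0]
  · apply mul_nonneg h0.le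
    have : 0 ≤ (u - 1) * (A2 - u - 1) := mul_nonneg (by linarith) (by linarith)
    nlinarith

/-- From `Z = 1` to `Z = 2`. -/
lemma nf_one_two (a c y : ℤ) (ha : 2 ≤ a) (hc : 3 ≤ c) (hy : 0 ≤ y) (h : 4 ≤ c ∨ 1 ≤ y) :
    nf a c 1 y ≤ nf a c 2 y := by
  have h1 : nf a c 2 y - nf a c 1 y = (a * (c - 3) + (c - 3)^2 - 2)
      + y * (a * c * (c - 3) + a^2 * (c - 3) + 3) + y^2 * (2 * a + c) := by unfold nf; ring
  have h2 : 0 ≤ a * c * (c - 3) + a^2 * (c - 3) := by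
    have : 0 ≤ c - 3 := by linarith
    positivity
  have h4 : 0 ≤ y * (a * c * (c - 3) + a^2 * (c - 3)) := mul_nonneg hy h2
  have h5 : 0 ≤ y^2 * (2 * a + c) := by positivity
  rcases h with h | h
  · have : 2 ≤ a * (c - 3) := by nlinarith
    nlinarith [sq_nonneg (c - 3)]
  · have : 0 ≤ a * (c - 3) := mul_nonneg (by linarith) (by linarith)
    nlinarith [sq_nonneg (c - 3)]

lemma nf_zero (a c : ℤ) : nf a c 0 0 = 1 := by unfold nf; ring

lemma nf_even (a L Z y : ℤ) (hL : 1 ≤ L) (hLa : L ≤ a - 2) (hZ : 0 ≤ Z)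
    (hZc : Z ≤ 2 * L) (hy : 0 ≤ y) (hya : y ≤ a - 1) (hyZ : y ≤ a * Z) :
    nf a (2 * L) Z y ≤ nf a (2 * L) (L + 1) (a - 1) := by
  have h2 : ∀ y, 0 ≤ y → y ≤ a - 1 → ∀ Z, 2 ≤ Z → Z ≤ 2 * L →
      nf a (2 * L) Z y ≤ nf a (2 * L) (L + 1) (a - 1) := fun y hy hya Z hZ hZc =>
    (nf_mono_y a (2 * L) Z y (by linarith) (by linarith) hZ hZc hy hya).trans
      (nf_top_even a L Z hL hLa (by linarith) hZc)
  have h1 : ∀ y, 0 ≤ y → y ≤ a - 1 → nf a (2 * L) 1 y ≤ nf a (2 * L) (L + 1) (a - 1) := by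
    intro y hy hya
    rcases eq_or_lt_of_le hL with h | h
    · subst h
      have e : nf a (2 * 1) (1 + 1) (a - 1) - nf a (2 * 1) 1 y =
        a^3 + 4*a^2 - 7*a - y*(a^2 + 3*a + 1) - 2*y^2 + y^3 := by unfold nf; ring
      obtain ⟨d, hd⟩ : ∃ d, a = y + 1 + d := ⟨a - y - 1, by ring⟩
      have hd0 : 0 ≤ d := by linarith
      suffices 0 ≤ a^3 + 4*a^2 - 7*a - y*(a^2 + 3*a + 1) - 2*y^2 + y^3 by linarith
      have e1 : 0 ≤ (a - 1 - y) * (3 * a + 1 + 2 * (a - 1 + y)) :=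
        mul_nonneg (by linarith) (by linarith)
      suffices 0 ≤ a^3 - a^2 * y + y^3 - a^2 - a - 1 by nlinarith
      rcases eq_or_lt_of_le hd0 with h0 | h0
      · subst h0
        have : y = a - 1 := by linarith
        subst this
        have : 0 ≤ (a - 3) * a ^ 2 := mul_nonneg (by linarith) (by positivity)
        nlinarith
      · have : 0 ≤ (a - y - 2) * a ^ 2 := mul_nonneg (by linarith) (by positivity)
        have : 0 ≤ y ^ 3 := by positivity
        nlinarith
    · exact (nf_one_two a (2 * L) y (by linarith) (by linarith) hy (Or.inl (by linarith))).trans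
        (h2 y hy hya 2 le_rfl (by linarith))
  have h3 := h1 0 le_rfl (by linarith)
  rcases (by omega : Z = 0 ∨ Z = 1 ∨ 2 ≤ Z) with h | h | h
  · subst h
    have : y = 0 := by linarith
    subst this
    rw [nf_zero]
    refine le_trans ?_ h3
    have e : nf a (2 * L) 1 0 = a * (2 * L - 1) + 2 * L * (2 * L - 2) + 2 := by unfold nf; ring
    rw [e]
    have := mul_nonneg (by linarith : 0 ≤ a) (by linarith : 0 ≤ 2 * L - 1)
    have := mul_nonneg (by linarith : 0 ≤ 2 * L) (by linarith : 0 ≤ 2 * L - 2)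
    linarith
  · subst h; exact h1 y hy hya
  · exact h2 y hy hya Z h hZc

lemma nf_odd (a L Z y : ℤ) (ha : 2 ≤ a) (hL : 1 ≤ L) (hLa : L ≤ a + 1) (hZ : 0 ≤ Z)
    (hZc : Z ≤ 2 * L + 1) (hy : 0 ≤ y) (hya : y ≤ a - 1) (hyZ : y ≤ a * Z) :
    nf a (2 * L + 1) Z y ≤ nf a (2 * L + 1) (L + 1) (a - 1) := by
  have h2 : ∀ y, 0 ≤ y → y ≤ a - 1 → ∀ Z, 2 ≤ Z → Z ≤ 2 * L + 1 →
      nf a (2 * L + 1) Z y ≤ nf a (2 * L + 1) (L + 1) (a - 1) := fun y hy hya Z hZ hZc =>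
    (nf_mono_y a (2 * L + 1) Z y (by linarith) (by linarith) hZ hZc hy hya).trans
      (nf_top_odd a L Z ha hL hLa (by linarith) hZc)
  have h1 : ∀ y, 0 ≤ y → y ≤ a - 1 → nf a (2 * L + 1) 1 y ≤ nf a (2 * L + 1) (L + 1) (a - 1) := by
    intro y hy hya
    by_cases h : 4 ≤ 2 * L + 1 ∨ 1 ≤ y
    · exact (nf_one_two a (2 * L + 1) y (by linarith) (by linarith) hy h).trans
        (h2 y hy hya 2 le_rfl (by linarith))
    · push Not at h
      have hL1 : L = 1 := by omega
      have hy0 : y = 0 := by omega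
      subst hL1 hy0
      obtain ⟨A, hA⟩ : ∃ A, a = 2 + A := ⟨a - 2, by ring⟩
      have hA0 : 0 ≤ A := by linarith
      rw [hA, ← sub_nonneg]; unfold nf; ring_nf; positivity
  have h3 := h1 0 le_rfl (by linarith)
  rcases (by omega : Z = 0 ∨ Z = 1 ∨ 2 ≤ Z) with h | h | h
  · subst h
    have : y = 0 := by linarith
    subst this
    rw [nf_zero]
    refine le_trans ?_ h3
    have e : nf a (2 * L + 1) 1 0 = a * (2 * L) + (2 * L + 1) * (2 * L - 1) + 2 := by
      unfold nf; ring
    rw [e]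
    have := mul_nonneg (by linarith : 0 ≤ a) (by linarith : 0 ≤ 2 * L)
    have := mul_nonneg (by linarith : 0 ≤ 2 * L + 1) (by linarith : 0 ≤ 2 * L - 1)
    linarith
  · subst h; exact h1 y hy hya
  · exact h2 y hy hya Z h hZc

/-! ### Real roots -/

section Roots

variable {a b : ℤ}

/-- The defining cubic at a real number. -/
def fr (a b : ℤ) (s : ℝ) : ℝ := s ^ 3 - ((a : ℝ) + (b : ℝ)) * s ^ 2 + (a : ℝ) * (b : ℝ) * s - 1

lemma fr_eq (a b : ℤ) (s : ℝ) : fr a b s = s * (s - a) * (s - b) - 1 := by unfold fr; ring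

lemma fr_root_pos (ha : 2 ≤ a) (hab : a + 2 ≤ b) {s : ℝ} (hs : fr a b s = 0) : 0 < s := by
  by_contra h
  push Not at h
  have ha' : (2 : ℝ) ≤ a := by exact_mod_cast ha
  have hb' : (a : ℝ) + 2 ≤ b := by exact_mod_cast hab
  rw [fr_eq] at hs
  have : 0 ≤ (s - a) * (s - b) := mul_nonneg_of_nonpos_of_nonpos (by linarith) (by linarith)
  nlinarith

lemma fr_root_ne {s : ℝ} (hs : fr a b s = 0) : s - a ≠ 0 := by
  intro h
  rw [fr_eq, h] at hs
  norm_num at hs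

lemma exists_roots_s19 (ha : 2 ≤ a) (hab : a + 2 ≤ b) : ∃ s1 s2 s3 : ℝ,
    fr a b s1 = 0 ∧ fr a b s2 = 0 ∧ fr a b s3 = 0 ∧ (b : ℝ) < s1 ∧ (a : ℝ) - 1 < s2 ∧ s2 < a ∧
    0 < s3 ∧ s3 < 1 := by
  have ha' : (2 : ℝ) ≤ a := by exact_mod_cast ha
  have hb' : (a : ℝ) + 2 ≤ b := by exact_mod_cast hab
  have hc : Continuous (fr a b) := by unfold fr; fun_prop
  obtain ⟨s1, h1, h1'⟩ := intermediate_value_Ioo (f := fr a b) (a := (b : ℝ)) (b := (b : ℝ) + 1) (by linarith)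
    hc.continuousOn (show (0 : ℝ) ∈ _ from ⟨by rw [fr_eq]; norm_num, by rw [fr_eq]; nlinarith⟩)
  obtain ⟨s2, h2, h2'⟩ := intermediate_value_Ioo' (f := fr a b) (a := (a : ℝ) - 1) (b := (a : ℝ)) (by linarith)
    hc.continuousOn (show (0 : ℝ) ∈ _ from ⟨by rw [fr_eq]; norm_num, by rw [fr_eq]; nlinarith⟩)
  obtain ⟨s3, h3, h3'⟩ := intermediate_value_Ioo (f := fr a b) (a := (0 : ℝ)) (b := (1 : ℝ)) (by linarith)
    hc.continuousOn (show (0 : ℝ) ∈ _ from ⟨by rw [fr_eq]; norm_num, by rw [fr_eq]; nlinarith⟩)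
  exact ⟨s1, s2, s3, h1', h2', h3', h1.1, h2.1, h2.2, h3.1, h3.2⟩

/-- Positivity of the two supporting functionals. -/
lemma functional_pos (ha : 2 ≤ a) (hab : a + 2 ≤ b) {s1 s2 s3 : ℝ}
    (h1 : fr a b s1 = 0) (h2 : fr a b s2 = 0) (h3 : fr a b s3 = 0)
    (hb1 : (b : ℝ) < s1) (ha2 : (a : ℝ) - 1 < s2) (h2a : s2 < a) (h30 : 0 < s3) (h31 : s3 < 1)
    (X Y Z : ℝ)
    (p1 : 0 < X + Y * s1 + Z * (s1 * (s1 - a)))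
    (p2 : 0 < X + Y * s2 + Z * (s2 * (s2 - a)))
    (p3 : 0 < X + Y * s3 + Z * (s3 * (s3 - a))) :
    0 < a * (X + Y) ∧ 0 < a * X + (a ^ 2 - 1) * Y := by
  have ha' : (2 : ℝ) ≤ a := by exact_mod_cast ha
  have hb' : (a : ℝ) + 2 ≤ b := by exact_mod_cast hab
  unfold fr at h1 h2 h3
  generalize (a : ℝ) = A at *
  generalize (b : ℝ) = B at *
  have d12 : 0 < s1 - s2 := by linarith
  have d13 : 0 < s1 - s3 := by linarith
  have d23 : 0 < s2 - s3 := by linarith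
  have k12 : s1 ^ 2 + s1 * s2 + s2 ^ 2 - (A + B) * (s1 + s2) + A * B = 0 := by
    have : (s1 - s2) * (s1 ^ 2 + s1 * s2 + s2 ^ 2 - (A + B) * (s1 + s2) + A * B) = 0 := by
      linear_combination h1 - h2
    exact (mul_eq_zero.1 this).resolve_left d12.ne'
  have k13 : s1 ^ 2 + s1 * s3 + s3 ^ 2 - (A + B) * (s1 + s3) + A * B = 0 := by
    have : (s1 - s3) * (s1 ^ 2 + s1 * s3 + s3 ^ 2 - (A + B) * (s1 + s3) + A * B) = 0 := by
      linear_combination h1 - h3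
    exact (mul_eq_zero.1 this).resolve_left d13.ne'
  have e1 : s1 + s2 + s3 = A + B := by
    have : (s2 - s3) * (s1 + s2 + s3 - (A + B)) = 0 := by
      linear_combination k12 - k13
    linarith [(mul_eq_zero.1 this).resolve_left d23.ne']
  have hB : B = s1 + s2 + s3 - A := by linarith
  have e2 : s1 * s2 + s1 * s3 + s2 * s3 = A * B := by
    rw [← e1] at k12; linear_combination -k12
  have e3 : s1 * s2 * s3 = 1 := by
    rw [← e1, ← e2] at h1; linear_combination h1
  have e4 : (s1 - A) * (A - s2) * (A - s3) = 1 := by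
    linear_combination A ^ 2 * e1 - A * e2 + e3
  have s1p : 0 < s1 := by linarith
  have s2p : 0 < s2 := by linarith
  have q23 : 0 < s2 * s3 := mul_pos s2p h30
  have r23 : 0 < (A - s2) * (A - s3) := mul_pos (by linarith) (by linarith)
  have r13 : 2 * 1 < (s1 - A) * (A - s3) :=
    mul_lt_mul'' (by linarith) (by linarith) (by norm_num) (by norm_num)
  have t13 : (A - 1) * (s1 * s3) < 1 := by
    have h0 : 0 < s1 * s3 := mul_pos s1p h30
    have := mul_lt_mul_of_pos_right ha2 h0
    linarith
  have u13 : s1 * s3 < 2 := by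
    have h0 : 0 < s1 * s3 := mul_pos s1p h30
    have := mul_le_mul_of_nonneg_right (by linarith : 1 ≤ A - 1) h0.le
    linarith
  have r12 : (A - 1) * ((s1 - A) * (A - s2)) < 1 := by
    have h0 : 0 < (s1 - A) * (A - s2) := mul_pos (by linarith) (by linarith)
    have := mul_lt_mul_of_pos_right (by linarith : A - 1 < A - s3) h0
    linarith
  have t12 : A + 2 < s1 * s2 := by
    have := mul_lt_mul_of_pos_left (by linarith : 1 < s2) s1p
    linarith
  have V : 0 < (s1 - s2) * (s1 - s3) * (s2 - s3) := by positivity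
  constructor
  · have P1 : 0 < (A - 1) * (s2 * s3) + (A - s2) * (A - s3) := by
      have : 0 < A - 1 := by linarith
      positivity
    have P2 : 0 < -((A - 1) * (s1 * s3) + (A - s1) * (A - s3)) := by linarith
    have P3 : 0 < (A - 1) * (s1 * s2) + (A - s1) * (A - s2) := by
      have h0 : 0 < (s1 - A) * (A - s2) := mul_pos (by linarith) (by linarith)
      have i1 := mul_le_mul_of_nonneg_right (by linarith : 1 ≤ A - 1) h0.le
      have i2 := mul_le_mul_of_nonneg_right (by linarith : 1 ≤ A - 1) (by linarith : 0 ≤ s1 * s2)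
      linarith
    have I : (A * (X + Y)) * ((s1 - s2) * (s1 - s3) * (s2 - s3)) =
        (X + Y * s1 + Z * (s1 * (s1 - A))) * ((A - 1) * (s2 * s3) + (A - s2) * (A - s3)) * (s2 - s3)
        + (X + Y * s2 + Z * (s2 * (s2 - A))) * (-((A - 1) * (s1 * s3) + (A - s1) * (A - s3))) * (s1 - s3)
        + (X + Y * s3 + Z * (s3 * (s3 - A))) * ((A - 1) * (s1 * s2) + (A - s1) * (A - s2)) * (s1 - s2) := by
      ring
    have : 0 < (A * (X + Y)) * ((s1 - s2) * (s1 - s3) * (s2 - s3)) := by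
      rw [I]; positivity
    exact pos_of_mul_pos_left this V.le
  · have A2 : 2 * 2 ≤ A * A := mul_le_mul ha' ha' (by norm_num) (by linarith)
    have A1 : 0 < A ^ 2 - 1 := by linarith
    have P1 : 0 < s2 * s3 + (A ^ 2 - 1) * ((A - s2) * (A - s3)) := by positivity
    have P2 : 0 < -(s1 * s3 + (A ^ 2 - 1) * ((A - s1) * (A - s3))) := by
      have := mul_le_mul_of_nonneg_right (by linarith : 1 ≤ A ^ 2 - 1)
        (by linarith : 0 ≤ (s1 - A) * (A - s3))
      linarith
    have P3 : 0 < s1 * s2 + (A ^ 2 - 1) * ((A - s1) * (A - s2)) := by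
      have : (A + 1) * ((A - 1) * ((s1 - A) * (A - s2))) < (A + 1) * 1 :=
        mul_lt_mul_of_pos_left r12 (by linarith)
      linarith
    have I : (A * (A * X + (A ^ 2 - 1) * Y)) * ((s1 - s2) * (s1 - s3) * (s2 - s3)) =
        (X + Y * s1 + Z * (s1 * (s1 - A))) * (s2 * s3 + (A ^ 2 - 1) * ((A - s2) * (A - s3))) * (s2 - s3)
        + (X + Y * s2 + Z * (s2 * (s2 - A))) * (-(s1 * s3 + (A ^ 2 - 1) * ((A - s1) * (A - s3)))) * (s1 - s3)
        + (X + Y * s3 + Z * (s3 * (s3 - A))) * (s1 * s2 + (A ^ 2 - 1) * ((A - s1) * (A - s2))) * (s1 - s2) := by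
      ring
    have : 0 < (A * (A * X + (A ^ 2 - 1) * Y)) * ((s1 - s2) * (s1 - s3) * (s2 - s3)) := by
      rw [I]; positivity
    exact pos_of_mul_pos_right (pos_of_mul_pos_left this V.le) (by linarith)

end Roots

/-! ### The order `ℤ[g]` -/

section Order

variable {K : Type*} [Field K] {a b : ℤ} {g : K}

/-- Coordinates with respect to `1, g, g (g - a)`. -/
def el (g : K) (a X Y Z : ℤ) : K := (X : K) + Y * g + Z * (g * (g - a))

lemma el_mem (a X Y Z : ℤ) : el g a X Y Z ∈ Algebra.adjoin ℤ {g} := by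
  have hg : g ∈ Algebra.adjoin ℤ {g} := Algebra.self_mem_adjoin_singleton ℤ g
  have hi : ∀ n : ℤ, (n : K) ∈ Algebra.adjoin ℤ {g} := fun n => intCast_mem _ n
  unfold el
  exact add_mem (add_mem (hi _) (mul_mem (hi _) hg)) (mul_mem (hi _) (mul_mem hg (sub_mem hg (hi _))))

lemma el_add (X Y Z X' Y' Z' : ℤ) :
    el g a X Y Z + el g a X' Y' Z' = el g a (X + X') (Y + Y') (Z + Z') := by
  unfold el; push_cast; ring

lemma mul_g (hg : g ^ 3 - ((a : K) + b) * g ^ 2 + a * b * g - 1 = 0) (X Y Z : ℤ) :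
    g * el g a X Y Z = el g a Z (X + a * Y) (Y + b * Z) := by
  unfold el; push_cast; linear_combination (Z : K) * hg

lemma mul_h (hg : g ^ 3 - ((a : K) + b) * g ^ 2 + a * b * g - 1 = 0) (X Y Z : ℤ) :
    (g - a) * el g a X Y Z = el g a (-a * X + Z) X (Y + (b - a) * Z) := by
  unfold el; push_cast; linear_combination (Z : K) * hg

lemma exists_el (hg : g ^ 3 - ((a : K) + b) * g ^ 2 + a * b * g - 1 = 0) {x : K}
    (hx : x ∈ Algebra.adjoin ℤ {g}) : ∃ X Y Z : ℤ, x = el g a X Y Z := by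
  induction hx using Algebra.adjoin_induction with
  | mem x hx => 
    rw [Set.mem_singleton_iff] at hx
    exact ⟨0, 1, 0, by rw [hx]; simp [el]⟩
  | algebraMap r => exact ⟨r, 0, 0, by simp [el]⟩
  | add x y _ _ hx hy =>
    obtain ⟨X, Y, Z, rfl⟩ := hx
    obtain ⟨X', Y', Z', rfl⟩ := hy
    exact ⟨_, _, _, el_add ..⟩
  | mul x y _ _ hx hy =>
    obtain ⟨X, Y, Z, rfl⟩ := hx
    obtain ⟨X', Y', Z', rfl⟩ := hy
    have h1 := mul_g hg X' Y' Z'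
    have h2 := mul_h hg X' Y' Z'
    have h3 := mul_g hg (-a * X' + Z') X' (Y' + (b - a) * Z')
    have : el g a X Y Z * el g a X' Y' Z' = X * el g a X' Y' Z' + Y * (g * el g a X' Y' Z')
        + Z * (g * ((g - a) * el g a X' Y' Z')) := by
      conv_lhs => rw [el]
      ring
    rw [this, h2, h3, h1]
    have hs : ∀ n X Y Z : ℤ, (n : K) * el g a X Y Z = el g a (n * X) (n * Y) (n * Z) := by
      intros; unfold el; push_cast; ring
    rw [hs, hs, hs, el_add, el_add]
    exact ⟨_, _, _, rfl⟩

lemma TotallyPositive.mul {x y : K} (hx : TotallyPositive x) (hy : TotallyPositive y) :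
    TotallyPositive (x * y) := fun φ => by rw [map_mul]; exact mul_pos (hx φ) (hy φ)

lemma IsIndecomposableIn.unit_mul {O : Subalgebra ℤ K} {u u' x : K} (hu : u ∈ O) (hu' : u' ∈ O)
    (huu : u * u' = 1) (tu : TotallyPositive u) (tu' : TotallyPositive u')
    (hx : IsIndecomposableIn O x) : IsIndecomposableIn O (u * x) := by
  refine ⟨mul_mem hu hx.1, tu.mul hx.2.1, ?_⟩
  rintro ⟨β, γ, hβ, hγ, tβ, tγ, h⟩
  refine hx.2.2 ⟨u' * β, u' * γ, mul_mem hu' hβ, mul_mem hu' hγ, tu'.mul tβ, tu'.mul tγ, ?_⟩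
  linear_combination u' * h - x * huu

lemma map_root (hg : g ^ 3 - ((a : K) + b) * g ^ 2 + a * b * g - 1 = 0) (φ : K →+* ℝ) :
    fr a b (φ g) = 0 := by
  have := congrArg φ hg
  simpa [fr] using this

lemma map_el (φ : K →+* ℝ) (X Y Z : ℤ) :
    φ (el g a X Y Z) = X + Y * φ g + Z * (φ g * (φ g - a)) := by
  simp [el]

/-- Elements of the first cone are totally positive. -/
lemma tp_cone1_s19 (ha : 2 ≤ a) (hab : a + 2 ≤ b)
    (hg : g ^ 3 - ((a : K) + b) * g ^ 2 + a * b * g - 1 = 0) {X Y Z : ℤ}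
    (hY : 0 ≤ Y) (hZ : 0 ≤ Z) (hX : Z ≤ (b - a) * X) (hne : 0 < X ∨ 0 < Y) :
    TotallyPositive (el g a X Y Z) := by
  intro φ
  rw [map_el]
  have hr := map_root hg φ
  have hs := fr_root_pos ha hab hr
  have hn := fr_root_ne hr
  generalize φ g = s at *
  have hY' : (0 : ℝ) ≤ Y := by exact_mod_cast hY
  have hZ' : (0 : ℝ) ≤ Z := by exact_mod_cast hZ
  have hX' : (0 : ℝ) ≤ ((b : ℝ) - a) * X - Z := by
    have : (Z : ℝ) ≤ ((b : ℝ) - a) * X := by exact_mod_cast hX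
    linarith
  have hc : (0 : ℝ) < (b : ℝ) - a := by
    have : (a : ℝ) + 2 ≤ b := by exact_mod_cast hab
    linarith
  have hw : 0 < s * (s - a) ^ 2 := by positivity
  rw [fr_eq] at hr
  have key : ((b : ℝ) - a) * (X + Y * s + Z * (s * (s - a))) =
      (((b : ℝ) - a) * X - Z) + ((b : ℝ) - a) * Y * s + Z * (s * (s - a) ^ 2) := by
    linear_combination -(Z : ℝ) * hr
  have : 0 < ((b : ℝ) - a) * (X + Y * s + Z * (s * (s - a))) := by
    rw [key]
    rcases hne with h | h
    · have h' : (0 : ℝ) < X := by exact_mod_cast h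
      rcases eq_or_lt_of_le hZ' with h0 | h0
      · rw [← h0]; simp only [sub_zero, zero_mul, add_zero]; positivity
      · have : 0 < Z * (s * (s - a) ^ 2) := by positivity
        have : 0 ≤ ((b : ℝ) - a) * Y * s := by positivity
        linarith
    · have h' : (0 : ℝ) < Y := by exact_mod_cast h
      have : 0 ≤ Z * (s * (s - a) ^ 2) := by positivity
      have : 0 < ((b : ℝ) - a) * Y * s := by positivity
      linarith
  exact pos_of_mul_pos_right this hc.le

/-- Elements of the second cone are totally positive. -/
lemma tp_cone2_s19 (ha : 2 ≤ a) (hab : a + 2 ≤ b)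
    (hg : g ^ 3 - ((a : K) + b) * g ^ 2 + a * b * g - 1 = 0) {X y Z : ℤ}
    (hy : 0 ≤ y) (hZ : y ≤ a * Z) (hX : a * Z - y ≤ a * (b - a) * (X - a * y))
    (hne : 0 < y ∨ 0 < X - a * y) :
    TotallyPositive (el g a X (-y) Z) := by
  intro φ
  rw [map_el]
  have hr := map_root hg φ
  have hs := fr_root_pos ha hab hr
  have hn := fr_root_ne hr
  generalize φ g = s at *
  have ha' : (0 : ℝ) < a := by exact_mod_cast (by linarith : 0 < a)
  have hy' : (0 : ℝ) ≤ y := by exact_mod_cast hy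
  have hZ' : (0 : ℝ) ≤ a * Z - y := by
    have : (y : ℝ) ≤ a * Z := by exact_mod_cast hZ
    linarith
  have hX' : (0 : ℝ) ≤ a * ((b : ℝ) - a) * (X - a * y) - (a * Z - y) := by
    have : (a : ℝ) * Z - y ≤ a * ((b : ℝ) - a) * (X - a * y) := by exact_mod_cast hX
    linarith
  have hc : (0 : ℝ) < (b : ℝ) - a := by
    have : (a : ℝ) + 2 ≤ b := by exact_mod_cast hab
    linarith
  have hv : 0 < (s - a) ^ 2 := by positivity
  have hw : 0 < s * (s - a) ^ 2 := by positivity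
  rw [fr_eq] at hr
  have key : (a * ((b : ℝ) - a)) * (X + (-y : ℤ) * s + Z * (s * (s - a))) =
      (a * ((b : ℝ) - a) * (X - a * y) - (a * Z - y)) + ((b : ℝ) - a) * y * (s - a) ^ 2
        + (a * Z - y) * (s * (s - a) ^ 2) := by
    push_cast
    linear_combination -((a : ℝ) * Z - y) * hr
  have : 0 < (a * ((b : ℝ) - a)) * (X + (-y : ℤ) * s + Z * (s * (s - a))) := by
    rw [key]
    rcases hne with h | h
    · have h' : (0 : ℝ) < y := by exact_mod_cast h
      have : 0 ≤ (a * Z - y) * (s * (s - a) ^ 2) := by positivity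
      have : 0 < ((b : ℝ) - a) * y * (s - a) ^ 2 := by positivity
      linarith
    · have h' : (0 : ℝ) < X - a * y := by exact_mod_cast h
      have h2 : 0 ≤ ((b : ℝ) - a) * y * (s - a) ^ 2 := by positivity
      rcases eq_or_lt_of_le hZ' with h0 | h0
      · rw [← h0]; simp only [sub_zero, zero_mul, add_zero]; positivity
      · have : 0 < (a * Z - y) * (s * (s - a) ^ 2) := by positivity
        linarith
  exact pos_of_mul_pos_right this (by positivity)

/-- If an indecomposable is written as a sum, one summand is not totally positive. -/
lemma ind_contra {X Y Z : ℤ} (h : IsIndecomposableIn (Algebra.adjoin ℤ {g}) (el g a X Y Z))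
    (X' Y' Z' : ℤ) (h1 : TotallyPositive (el g a X' Y' Z'))
    (h2 : TotallyPositive (el g a (X - X') (Y - Y') (Z - Z'))) : False :=
  h.2.2 ⟨_, _, el_mem a _ _ _, el_mem a _ _ _, h1, h2, by rw [el_add]; congr 1 <;> ring⟩

lemma class1 (φ : K →+* ℝ) (ha : 2 ≤ a) (hab : a + 2 ≤ b)
    (hg : g ^ 3 - ((a : K) + b) * g ^ 2 + a * b * g - 1 = 0) {X Y Z : ℤ}
    (hY : 0 ≤ Y) (hZ : 0 ≤ Z) (hX : Z ≤ (b - a) * X)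
    (h : IsIndecomposableIn (Algebra.adjoin ℤ {g}) (el g a X Y Z)) :
    (X = 0 ∧ Y = 1 ∧ Z = 0) ∨ (X = 1 ∧ Y = 0 ∧ Z ≤ b - a) := by
  have hX0 : 0 ≤ X := by nlinarith
  rcases eq_or_lt_of_le hY with h0 | h0
  · right
    subst h0
    rcases (by omega : X = 0 ∨ X = 1 ∨ 2 ≤ X) with h1 | h1 | h1
    · subst h1
      exfalso
      have : Z = 0 := by linarith
      subst this
      have h2 := h.2.1 φ
      simp [el] at h2
    · subst h1; simpa using hX
    · exfalso
      rcases le_total Z (b - a) with h2 | h2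
      · exact ind_contra h 1 0 Z (tp_cone1_s19 ha hab hg le_rfl hZ (by linarith) (by simp))
          (tp_cone1_s19 ha hab hg (by simp) (by simp) (by nlinarith) (by left; linarith))
      · exact ind_contra h 1 0 (b - a) (tp_cone1_s19 ha hab hg le_rfl (by linarith) (by linarith) (by simp))
          (tp_cone1_s19 ha hab hg (by simp) (by linarith) (by linarith) (by left; linarith))
  · left
    by_contra hcon
    have hne : 0 < X ∨ 0 < Y - 1 := by
      by_contra hh
      push Not at hh
      have e1 : X = 0 := by linarith
      have e2 : Y = 1 := by linarith
      subst e1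
      exact hcon ⟨rfl, e2, by linarith⟩
    exact ind_contra h 0 1 0 (tp_cone1_s19 ha hab hg (by simp) le_rfl (by simp) (by simp))
      (tp_cone1_s19 ha hab hg (by linarith) (by linarith) (by linarith) (by simpa using hne))

lemma class2 (φ : K →+* ℝ) (ha : 2 ≤ a) (hab : a + 2 ≤ b)
    (hg : g ^ 3 - ((a : K) + b) * g ^ 2 + a * b * g - 1 = 0) {X y Z : ℤ}
    (hy : 0 ≤ y) (hZ : y ≤ a * Z) (hX : a * Z - y ≤ a * (b - a) * (X - a * y))
    (h : IsIndecomposableIn (Algebra.adjoin ℤ {g}) (el g a X (-y) Z)) :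
    (X = a ^ 2 ∧ y = a ∧ Z = 1) ∨ (X = 0 ∧ y = -1 ∧ Z = 0) ∨
      (X = a * y + 1 ∧ y ≤ a - 1 ∧ 0 ≤ Z ∧ Z ≤ b - a) := by
  have hZ0 : 0 ≤ Z := by nlinarith
  have hac : 0 < a * (b - a) := mul_pos (by linarith) (by linarith)
  have hX0 : 0 ≤ X - a * y := by nlinarith
  rcases le_or_gt a y with h0 | h0
  · left
    by_contra hcon
    have hne : 0 < y - a ∨ 0 < (X - a ^ 2) - a * (y - a) := by
      by_contra hh
      push Not at hh
      have e2 : y = a := by linarith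
      subst e2
      have e1 : X - y * y = 0 := le_antisymm (by nlinarith) hX0
      rw [e1] at hX
      have : Z = 1 := by nlinarith
      exact hcon ⟨by linarith, rfl, this⟩
    refine ind_contra h (a ^ 2) (-a) 1 (tp_cone2_s19 ha hab hg (by linarith) (by linarith) ?_ (by left; linarith)) ?_
    · ring_nf; simp
    · have := tp_cone2_s19 (X := X - a ^ 2) (y := y - a) (Z := Z - 1) ha hab hg (by linarith) (by linarith)
        (by linarith) hne
      convert this using 2; ring
  · right
    rcases eq_or_lt_of_le hy with h1 | h1
    · subst h1
      have hX2 : Z ≤ (b - a) * X := by nlinarith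
      rcases class1 φ ha hab hg (by simp) hZ0 hX2 h with h2 | h2
      · left; omega
      · right; exact ⟨by linarith, by linarith, hZ0, h2.2.2⟩
    · right
      have hZ1 : 1 ≤ Z := by nlinarith
      have hX1 : 1 ≤ X - a * y := by
        by_contra hh
        have : X - a * y = 0 := by linarith
        rw [this] at hX
        nlinarith
      rcases eq_or_lt_of_le hX1 with h2 | h2
      · refine ⟨by linarith, by linarith, hZ0, ?_⟩
        rw [← h2] at hX
        have : a * (Z - (b - a)) < a * 1 := by linarith
        have := lt_of_mul_lt_mul_left this (by linarith)
        linarith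
      · exfalso
        rcases le_total (Z - 1) (b - a) with h3 | h3
        · refine ind_contra h 1 0 (Z - 1) (tp_cone1_s19 ha hab hg le_rfl (by linarith) (by linarith) (by simp)) ?_
          have := tp_cone2_s19 (X := X - 1) (y := y) (Z := 1) ha hab hg hy (by linarith)
            (by nlinarith) (Or.inl h1)
          convert this using 2 <;> ring
        · refine ind_contra h 1 0 (b - a) (tp_cone1_s19 ha hab hg le_rfl (by linarith) (by linarith) (by simp)) ?_
          have := tp_cone2_s19 (X := X - 1) (y := y) (Z := Z - (b - a)) ha hab hg hy (by nlinarith)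
            (by nlinarith) (Or.inl h1)
          convert this using 2; ring

end Order

/-! ### Reduction modulo units -/

section Reduction

variable {K : Type*} [Field K] {a b : ℤ} {g : K}

lemma reduce (ha : 2 ≤ a) (hab : a + 2 ≤ b)
    (hg : g ^ 3 - ((a : K) + b) * g ^ 2 + a * b * g - 1 = 0)
    (hfun : ∀ X Y Z : ℤ, TotallyPositive (el g a X Y Z) →
      0 < a * (X + Y) ∧ 0 < a * X + (a ^ 2 - 1) * Y)
    (N : K →* ℚ) (Ng : N g = 1) (Nh : N (g - a) = 1)
    {α : K} (hα : IsIndecomposableIn (Algebra.adjoin ℤ {g}) α) :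
    ∃ X Y Z : ℤ, IsIndecomposableIn (Algebra.adjoin ℤ {g}) (el g a X Y Z) ∧
      N (el g a X Y Z) = N α ∧
      ((0 ≤ Y ∧ 0 ≤ Z ∧ Z ≤ (b - a) * X) ∨
        (Y ≤ 0 ∧ -Y ≤ a * Z ∧ a * Z + Y ≤ a * (b - a) * (X + a * Y))) := by
  obtain ⟨Q, hQ⟩ : ∃ Q : ℤ → ℤ → ℤ → Prop, ∀ X Y Z, Q X Y Z ↔
      (IsIndecomposableIn (Algebra.adjoin ℤ {g}) (el g a X Y Z) ∧ N (el g a X Y Z) = N α) :=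
    ⟨_, fun _ _ _ => Iff.rfl⟩
  have hgO : g ∈ Algebra.adjoin ℤ {g} := Algebra.self_mem_adjoin_singleton ℤ g
  have hi : ∀ n : ℤ, (n : K) ∈ Algebra.adjoin ℤ {g} := fun n => intCast_mem _ n
  have tg : TotallyPositive g := fun φ => fr_root_pos ha hab (map_root hg φ)
  have gg' : g * ((g - a) * (g - b)) = 1 := by linear_combination hg
  have tg' : TotallyPositive ((g - a) * (g - b)) := fun φ => by
    have h1 := congrArg φ gg'
    rw [map_mul, map_one] at h1
    have h2 := tg φ
    by_contra h3
    nlinarith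
  have vv' : (g - a) ^ 2 * (g * (g - b)) ^ 2 = 1 := by
    have : (g - a) * (g * (g - b)) = 1 := by linear_combination hg
    rw [← mul_pow, this, one_pow]
  have tsq : ∀ x y : K, x ^ 2 * y ^ 2 = 1 → TotallyPositive (x ^ 2) := fun x y h φ => by
    have hx : x ≠ 0 := by rintro rfl; simp at h
    have : φ x ≠ 0 := by simpa using hx
    rw [map_pow]; positivity
  have mv : (g - a) ^ 2 ∈ Algebra.adjoin ℤ {g} := pow_mem (sub_mem hgO (hi _)) 2
  have mv' : (g * (g - b)) ^ 2 ∈ Algebra.adjoin ℤ {g} := pow_mem (mul_mem hgO (sub_mem hgO (hi _))) 2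
  have mg' : (g - a) * (g - b) ∈ Algebra.adjoin ℤ {g} :=
    mul_mem (sub_mem hgO (hi _)) (sub_mem hgO (hi _))
  have Ninv : ∀ u u' : K, u * u' = 1 → N u = 1 → N u' = 1 := fun u u' h h1 => by
    have := congrArg N h
    rwa [map_mul, h1, one_mul, map_one] at this
  have Nv : N ((g - a) ^ 2) = 1 := by rw [map_pow, Nh, one_pow]
  have step : ∀ u u' : K, u ∈ Algebra.adjoin ℤ {g} → u' ∈ Algebra.adjoin ℤ {g} → u * u' = 1 →
      TotallyPositive u → TotallyPositive u' → N u = 1 → ∀ X Y Z X' Y' Z' : ℤ,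
      u * el g a X Y Z = el g a X' Y' Z' → Q X Y Z → Q X' Y' Z' := by
    intro u u' hu hu' huu tu tu' Nu X Y Z X' Y' Z' he h
    rw [hQ] at h ⊢
    rw [← he]
    exact ⟨h.1.unit_mul hu hu' huu tu tu', by rw [map_mul, Nu, one_mul, h.2]⟩
  have Sg : ∀ X Y Z, Q X Y Z → Q Z (X + a * Y) (Y + b * Z) := fun X Y Z =>
    step g _ hgO mg' gg' tg tg' Ng _ _ _ _ _ _ (mul_g hg X Y Z)
  have Sg' : ∀ X Y Z, Q X Y Z → Q (Y - a * Z + a * b * X) (Z - b * X) X := fun X Y Z =>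
    step _ g mg' hgO (by rw [mul_comm]; exact gg') tg' tg (Ninv _ _ gg' Ng) _ _ _ _ _ _ (by
      have := mul_g hg (Y - a * Z + a * b * X) (Z - b * X) X
      have e : el g a X (Y - a * Z + a * b * X + a * (Z - b * X)) (Z - b * X + b * X)
        = el g a X Y Z := by congr 1 <;> ring
      rw [e] at this
      rw [← this]
      linear_combination (el g a (Y - a * Z + a * b * X) (Z - b * X) X) * gg')
  have Sv : ∀ X Y Z, Q X Y Z → Q (-a * (-a * X + Z) + (Y + (b - a) * Z)) (-a * X + Z)
      (X + (b - a) * (Y + (b - a) * Z)) := fun X Y Z =>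
    step ((g - a) ^ 2) _ mv mv' vv' (tsq _ _ vv') (tsq _ _ (by rw [mul_comm]; exact vv')) Nv
      _ _ _ _ _ _ (by rw [pow_two, mul_assoc, mul_h hg, mul_h hg])
  have Sv' : ∀ X Y Z, Q X Y Z → Q (Z - (b - a) * X - a * (b - a) * Y)
      (X + a * Y - (b - a) * Y - a * (b - a) * (Z - (b - a) * X - a * (b - a) * Y))
      (Y + a * (Z - (b - a) * X - a * (b - a) * Y)) := fun X Y Z =>
    step _ ((g - a) ^ 2) mv' mv (by rw [mul_comm]; exact vv') (tsq _ _ (by rw [mul_comm]; exact vv'))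
      (tsq _ _ vv') (Ninv _ _ vv' Nv) _ _ _ _ _ _ (by
      have : (g - a) ^ 2 * el g a (Z - (b - a) * X - a * (b - a) * Y)
        (X + a * Y - (b - a) * Y - a * (b - a) * (Z - (b - a) * X - a * (b - a) * Y))
        (Y + a * (Z - (b - a) * X - a * (b - a) * Y)) = el g a X Y Z := by
        rw [pow_two, mul_assoc, mul_h hg, mul_h hg]
        congr 1 <;> ring
      rw [← this]
      linear_combination (el g a (Z - (b - a) * X - a * (b - a) * Y)
        (X + a * Y - (b - a) * Y - a * (b - a) * (Z - (b - a) * X - a * (b - a) * Y))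
        (Y + a * (Z - (b - a) * X - a * (b - a) * Y))) * vv')
  obtain ⟨X0, Y0, Z0, h0⟩ := exists_el hg hα.1
  obtain ⟨m, ⟨X, Y, Z, hq, hm⟩, hmin⟩ := Int.exists_least_of_bdd
    (P := fun n => ∃ X Y Z, Q X Y Z ∧ (n = a * (X + Y) ∨ n = a * X + (a ^ 2 - 1) * Y))
    ⟨0, by
      rintro z ⟨X, Y, Z, hq, h⟩
      have := hfun X Y Z ((hQ _ _ _).1 hq).1.2.1
      rcases h with h | h <;> linarith⟩
    ⟨_, X0, Y0, Z0, (hQ _ _ _).2 (by rw [← h0]; exact ⟨hα, rfl⟩), Or.inl rfl⟩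
  refine ⟨X, Y, Z, ((hQ _ _ _).1 hq).1, ((hQ _ _ _).1 hq).2, ?_⟩
  have m1 : ∀ X Y Z, Q X Y Z → m ≤ a * (X + Y) := fun X Y Z h => hmin _ ⟨X, Y, Z, h, Or.inl rfl⟩
  have m2 : ∀ X Y Z, Q X Y Z → m ≤ a * X + (a ^ 2 - 1) * Y :=
    fun X Y Z h => hmin _ ⟨X, Y, Z, h, Or.inr rfl⟩
  have p1 : 0 < a ^ 2 - a - 1 := by nlinarith
  have p2 : 0 < a * (b - a) - 1 := by nlinarith
  rcases hm with hm | hm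
  · left
    have i1 := m2 _ _ _ hq
    have i2 := m2 _ _ _ (Sv _ _ _ hq)
    have i3 := m2 _ _ _ (Sg' _ _ _ hq)
    refine ⟨?_, ?_, by linarith⟩
    · exact nonneg_of_mul_nonneg_right (by linarith : 0 ≤ (a ^ 2 - a - 1) * Y) p1
    · exact nonneg_of_mul_nonneg_right (by linarith : 0 ≤ (a * (b - a) - 1) * Z) p2
  · right
    have i1 := m1 _ _ _ hq
    have i2 := m1 _ _ _ (Sg _ _ _ hq)
    have i3 := m1 _ _ _ (Sv' _ _ _ hq)
    refine ⟨?_, by linarith, ?_⟩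
    · have := nonneg_of_mul_nonneg_right (by linarith : 0 ≤ (a ^ 2 - a - 1) * (-Y)) p1
      linarith
    · have := nonneg_of_mul_nonneg_right (by linarith :
        0 ≤ (a * (b - a) - 1) * (a * (b - a) * (X + a * Y) - (a * Z + Y))) p2
      linarith

end Reduction

/-! ### The number field -/

section NumberField

variable {a b : ℤ} {ρ : ℝ}

lemma minpoly_eq (hroot : fr a b ρ = 0) (hdeg : Module.finrank ℚ ℚ⟮ρ⟯ = 3) :
    IsIntegral ℚ ρ ∧ minpoly ℚ ρ = Polynomial.X ^ 3 - Polynomial.C ((a : ℚ) + b) * Polynomial.X ^ 2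
      + Polynomial.C ((a : ℚ) * b) * Polynomial.X - Polynomial.C 1 := by
  set P : Polynomial ℚ := Polynomial.X ^ 3 - Polynomial.C ((a : ℚ) + b) * Polynomial.X ^ 2
      + Polynomial.C ((a : ℚ) * b) * Polynomial.X - Polynomial.C 1 with hP
  have hd : P.natDegree = 3 := by rw [hP]; compute_degree!
  have hm : P.Monic := by rw [hP]; monicity!
  have h0 : Polynomial.aeval ρ P = 0 := by
    rw [hP]; simpa [fr] using hroot
  have hint : IsIntegral ℚ ρ := ⟨P, hm, by simpa [Polynomial.aeval_def] using h0⟩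
  refine ⟨hint, ?_⟩
  refine (Polynomial.eq_of_monic_of_dvd_of_natDegree_le (minpoly.monic hint) hm
    (minpoly.dvd ℚ ρ h0) ?_).symm
  rw [hd, ← IntermediateField.adjoin.finrank hint, hdeg]

lemma gen_eq (hroot : fr a b ρ = 0) :
    (AdjoinSimple.gen ℚ ρ) ^ 3 - ((a : ℚ⟮ρ⟯) + b) * (AdjoinSimple.gen ℚ ρ) ^ 2
      + a * b * (AdjoinSimple.gen ℚ ρ) - 1 = 0 := by
  apply (algebraMap ℚ⟮ρ⟯ ℝ).injective
  simpa [fr] using hroot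

lemma exists_embedding (hroot : fr a b ρ = 0) (hdeg : Module.finrank ℚ ℚ⟮ρ⟯ = 3) {s : ℝ}
    (hs : fr a b s = 0) : ∃ φ : ℚ⟮ρ⟯ →+* ℝ, φ (AdjoinSimple.gen ℚ ρ) = s := by
  obtain ⟨hint, hmin⟩ := minpoly_eq hroot hdeg
  have h : Polynomial.aeval s (minpoly ℚ (adjoin.powerBasis hint).gen) = 0 := by
    have h1 : minpoly ℚ (AdjoinSimple.gen ℚ ρ) = minpoly ℚ ρ := by
      have := minpoly.algebraMap_eq (A := ℚ) (algebraMap ℚ⟮ρ⟯ ℝ).injective (AdjoinSimple.gen ℚ ρ)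
      rw [← this, AdjoinSimple.algebraMap_gen]
    rw [adjoin.powerBasis_gen, h1, hmin]
    simpa [fr] using hs
  refine ⟨((adjoin.powerBasis hint).lift s h).toRingHom, ?_⟩
  have := (adjoin.powerBasis hint).lift_gen s h
  rw [adjoin.powerBasis_gen] at this
  exact this

lemma exists_basis (hroot : fr a b ρ = 0) (hdeg : Module.finrank ℚ ℚ⟮ρ⟯ = 3) :
    ∃ B : Module.Basis (Fin 3) ℚ ℚ⟮ρ⟯, ∀ i, B i = (AdjoinSimple.gen ℚ ρ) ^ (i : ℕ) := by
  obtain ⟨hint, hmin⟩ := minpoly_eq hroot hdeg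
  have hd : (adjoin.powerBasis hint).dim = 3 := by
    rw [← hdeg, (adjoin.powerBasis hint).finrank]
  refine ⟨(adjoin.powerBasis hint).basis.reindex (finCongr hd), fun i => ?_⟩
  simp [adjoin.powerBasis_gen]

lemma exists_matrix (hroot : fr a b ρ = 0) (hdeg : Module.finrank ℚ ℚ⟮ρ⟯ = 3) :
    ∃ M : ℚ⟮ρ⟯ →ₐ[ℚ] Matrix (Fin 3) (Fin 3) ℚ, (∀ x, Algebra.norm ℚ x = (M x).det) ∧
      M (AdjoinSimple.gen ℚ ρ) = !![0, 0, 1; 1, 0, -((a : ℚ) * b); 0, 1, (a : ℚ) + b] := by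
  obtain ⟨B, hB⟩ := exists_basis hroot hdeg
  have hg := gen_eq hroot
  refine ⟨Algebra.leftMulMatrix B, fun x => Algebra.norm_eq_matrix_det B x, ?_⟩
  set g := AdjoinSimple.gen ℚ ρ with hgdef
  have h0 : g * B 0 = B 1 := by simp [hB]
  have h1 : g * B 1 = B 2 := by simp [hB, pow_two]
  have h2 : g * B 2 = (1 : ℚ) • B 0 + (-((a : ℚ) * b)) • B 1 + ((a : ℚ) + b) • B 2 := by
    simp only [hB, Algebra.smul_def]
    simp
    linear_combination hg
  ext i j
  rw [Algebra.leftMulMatrix_eq_repr_mul]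
  fin_cases j
  · fin_cases i <;> simp [h0]
  · fin_cases i <;> simp [h1]
  · fin_cases i <;> simp [h2]

lemma norm_facts (hroot : fr a b ρ = 0) (hdeg : Module.finrank ℚ ℚ⟮ρ⟯ = 3) :
    Algebra.norm ℚ (AdjoinSimple.gen ℚ ρ) = 1 ∧
    Algebra.norm ℚ (AdjoinSimple.gen ℚ ρ - (a : ℚ⟮ρ⟯)) = 1 ∧
    ∀ Z y : ℤ, Algebra.norm ℚ (el (AdjoinSimple.gen ℚ ρ) a (a * y + 1) (-y) Z)
      = (nf a (b - a) Z y : ℤ) := by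
  obtain ⟨M, hM, hMg⟩ := exists_matrix hroot hdeg
  refine ⟨?_, ?_, ?_⟩
  · rw [hM, hMg, Matrix.det_fin_three]; simp
  · rw [hM, map_sub, hMg, map_intCast, Matrix.det_fin_three]
    simp [Matrix.intCast_apply]
    ring
  · intro Z y
    rw [hM]
    unfold el
    simp only [map_add, map_mul, map_sub, map_intCast, hMg]
    have hcast : ∀ n : ℤ, (n : Matrix (Fin 3) (Fin 3) ℚ) = !![(n : ℚ), 0, 0; 0, n, 0; 0, 0, n] := by
      intro n
      ext i j
      fin_cases i <;> fin_cases j <;> simp [Matrix.intCast_apply]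
    have hsub : (!![0, 0, 1; 1, 0, -((a : ℚ) * b); 0, 1, (a : ℚ) + b] - !![(a : ℚ), 0, 0; 0, a, 0; 0, 0, a])
        = !![-(a : ℚ), 0, 1; 1, -a, -((a : ℚ) * b); 0, 1, (b : ℚ)] := by
      ext i j
      fin_cases i <;> fin_cases j <;> simp
    rw [hcast, hcast, hcast, hcast, hsub, Matrix.det_fin_three]
    simp [Matrix.mul_apply, Fin.sum_univ_three, nf]
    ring

end NumberField

lemma main_bound (a b : ℤ) (ha : 2 ≤ a) (hab : a + 2 ≤ b)
    (ρ : ℝ) (hroot : fr a b ρ = 0)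
    (hdeg : Module.finrank ℚ ℚ⟮ρ⟯ = 3)
    (α : ℚ⟮ρ⟯)
    (hind : IsIndecomposableIn (Algebra.adjoin ℤ {AdjoinSimple.gen ℚ ρ}) α) :
    ∃ Z y : ℤ, 0 ≤ Z ∧ Z ≤ b - a ∧ 0 ≤ y ∧ y ≤ a - 1 ∧ y ≤ a * Z ∧
      Algebra.norm ℚ α = (nf a (b - a) Z y : ℤ) := by
  have hg := gen_eq (a := a) (b := b) hroot
  obtain ⟨n1, n2, n3⟩ := norm_facts hroot hdeg
  obtain ⟨s1, s2, s3, h1, h2, h3, hb1, ha2, h2a, h30, h31⟩ := exists_roots_s19 ha hab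
  obtain ⟨φ1, hφ1⟩ := exists_embedding hroot hdeg h1
  obtain ⟨φ2, hφ2⟩ := exists_embedding hroot hdeg h2
  obtain ⟨φ3, hφ3⟩ := exists_embedding hroot hdeg h3
  have hfun : ∀ X Y Z : ℤ, TotallyPositive (el (AdjoinSimple.gen ℚ ρ) a X Y Z) →
      0 < a * (X + Y) ∧ 0 < a * X + (a ^ 2 - 1) * Y := by
    intro X Y Z h
    have p1 := h φ1
    have p2 := h φ2
    have p3 := h φ3
    rw [map_el, hφ1] at p1
    rw [map_el, hφ2] at p2
    rw [map_el, hφ3] at p3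
    have := functional_pos ha hab h1 h2 h3 hb1 ha2 h2a h30 h31 X Y Z p1 p2 p3
    exact_mod_cast this
  have hone : Algebra.norm ℚ α = 1 → ∃ Z y : ℤ, 0 ≤ Z ∧ Z ≤ b - a ∧ 0 ≤ y ∧ y ≤ a - 1 ∧ y ≤ a * Z ∧
      Algebra.norm ℚ α = (nf a (b - a) Z y : ℤ) := fun h =>
    ⟨0, 0, le_rfl, by linarith, le_rfl, by linarith, by simp, by rw [h, nf_zero]; simp⟩
  obtain ⟨X, Y, Z, hI, hN, hcase⟩ := reduce ha hab hg hfun (Algebra.norm ℚ) n1 n2 hind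
  rcases hcase with ⟨hY, hZ, hX⟩ | ⟨hY, hZ, hX⟩
  · rcases class1 φ1 ha hab hg hY hZ hX hI with ⟨rfl, rfl, rfl⟩ | ⟨rfl, rfl, h⟩
    · apply hone
      rw [← hN, ← n1]
      simp [el]
    · refine ⟨Z, 0, hZ, h, le_rfl, by linarith, by nlinarith, ?_⟩
      rw [← hN, ← n3]
      simp
  · obtain ⟨y, rfl⟩ : ∃ y, Y = -y := ⟨-Y, by ring⟩
    rcases class2 φ1 ha hab hg (by linarith) (by linarith) (by linarith) hI with
      ⟨rfl, rfl, rfl⟩ | ⟨rfl, rfl, rfl⟩ | ⟨rfl, h4, h5, h6⟩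
    · apply hone
      have : el (AdjoinSimple.gen ℚ ρ) y (y ^ 2) (-y) 1 = (AdjoinSimple.gen ℚ ρ - (y : ℚ⟮ρ⟯)) ^ 2 := by
        unfold el; push_cast; ring
      rw [← hN, this, map_pow, n2, one_pow]
    · linarith
    · exact ⟨Z, y, h5, h6, by linarith, h4, by linarith, by rw [← hN, ← n3]⟩

/-- Let `2 ≤ a ≤ b−2`, `(a,b) ≠ (2,4)`, and write `b − a = 2L + l₀` with
`L ≥ 0`, `l₀ ∈ {0,1}`. If `α` is indecomposable in `ℤ[ρ]`, then:
(1) if `l₀ = 0` and `1 ≤ L ≤ a−2`, then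
`N(α) ≤ L²a³ + (2L³ + L² + 1)a² − (2L³ + 3L² + L)a + L³ + L²`;
(2) if `l₀ = 1` and `1 ≤ L ≤ a+1`, then
`N(α) ≤ (L² + L)a³ + (2L³ + 4L² + 3L + 3)a² − (2L³ + 6L² + 5L + 3)a + L³ + 3L² + 2L + 1`. -/
theorem stmt_19 (a b L l₀ : ℤ) (ha : 2 ≤ a) (hab : a ≤ b - 2)
    (hexc : ¬ (a = 2 ∧ b = 4))
    (hL : 0 ≤ L) (hl₀ : l₀ = 0 ∨ l₀ = 1) (hbL : b - a = 2 * L + l₀)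
    (ρ : ℝ) (hroot : ρ ^ 3 - ((a : ℝ) + (b : ℝ)) * ρ ^ 2 + (a : ℝ) * (b : ℝ) * ρ - 1 = 0)
    (hmax : ∀ x : ℝ, x ^ 3 - ((a : ℝ) + (b : ℝ)) * x ^ 2 + (a : ℝ) * (b : ℝ) * x - 1 = 0 → x ≤ ρ)
    (hdeg : Module.finrank ℚ ℚ⟮ρ⟯ = 3)
    (α : ℚ⟮ρ⟯)
    (hind : IsIndecomposableIn (Algebra.adjoin ℤ {AdjoinSimple.gen ℚ ρ}) α) :
    (l₀ = 0 → 1 ≤ L → L ≤ a - 2 →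
      Algebra.norm ℚ α ≤
        ((L ^ 2 * a ^ 3 + (2 * L ^ 3 + L ^ 2 + 1) * a ^ 2
          - (2 * L ^ 3 + 3 * L ^ 2 + L) * a + L ^ 3 + L ^ 2 : ℤ) : ℚ)) ∧
    (l₀ = 1 → 1 ≤ L → L ≤ a + 1 →
      Algebra.norm ℚ α ≤
        (((L ^ 2 + L) * a ^ 3 + (2 * L ^ 3 + 4 * L ^ 2 + 3 * L + 3) * a ^ 2
          - (2 * L ^ 3 + 6 * L ^ 2 + 5 * L + 3) * a
          + L ^ 3 + 3 * L ^ 2 + 2 * L + 1 : ℤ) : ℚ)) := by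
  have hroot' : fr a b ρ = 0 := hroot
  obtain ⟨Z, y, hZ, hZc, hy, hya, hyZ, hN⟩ := main_bound a b ha (by linarith) ρ hroot' hdeg α hind
  rw [hN, hbL]
  rw [hbL] at hZc
  constructor
  · rintro rfl h1 h2
    rw [add_zero] at hZc ⊢
    have h := nf_even a L Z y h1 h2 hZ hZc hy hya hyZ
    have e : nf a (2 * L) (L + 1) (a - 1) = L ^ 2 * a ^ 3 + (2 * L ^ 3 + L ^ 2 + 1) * a ^ 2
          - (2 * L ^ 3 + 3 * L ^ 2 + L) * a + L ^ 3 + L ^ 2 := by unfold nf; ring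
    rw [e] at h
    exact Int.cast_le.2 h
  · rintro rfl h1 h2
    have h := nf_odd a L Z y ha h1 h2 hZ hZc hy hya hyZ
    have e : nf a (2 * L + 1) (L + 1) (a - 1) = (L ^ 2 + L) * a ^ 3
          + (2 * L ^ 3 + 4 * L ^ 2 + 3 * L + 3) * a ^ 2
          - (2 * L ^ 3 + 6 * L ^ 2 + 5 * L + 3) * a
          + L ^ 3 + 3 * L ^ 2 + 2 * L + 1 := by unfold nf; ring
    rw [e] at h
    exact Int.cast_le.2 h
end
end
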